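/- arXiv:1805.05996 — 2 statements merged into one kernel-verified Lean document; each statement's English description precedes it below -/
import Mathlib

section
/- Let d ≥ 19 be an integer and let G be an n-vertex Δ-critical simple graph with minimum degree at least d and maximum degree Δ ≥ (d+2)^(5d+10). Then α(G) < ((d+2+((d−1)·d)^(1/3)) / (2d+4+((d−1)·d)^(1/3)))·n. -/
open Finset

variable {V : Type*}

/-- `φ` is a proper edge coloring of `G` with colors in `{1, …, k}`, encoded as a symmetric
function on ordered pairs of vertices: every edge receives a color in `[1,k]` and two distinct
edges sharing a vertex receive different colors. -/
def IsEdgeColoring (G : SimpleGraph V) (k : ℕ) (φ : V → V → ℕ) : Prop :=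
  (∀ u v, φ u v = φ v u) ∧
  (∀ ⦃u v⦄, G.Adj u v → φ u v ∈ Finset.Icc 1 k) ∧
  (∀ ⦃v a b⦄, G.Adj v a → G.Adj v b → a ≠ b → φ v a ≠ φ v b)

/-- The chromatic index of `G`: the least `k` such that `G` has a proper edge `k`-coloring. -/
noncomputable def chromIndex (G : SimpleGraph V) : ℕ :=
  sInf {k | ∃ φ : V → V → ℕ, IsEdgeColoring G k φ}

/-- `G` is `Δ`-critical: `G` is connected, `χ'(G) = Δ + 1`, and `χ'(G - e) = Δ` for every
edge `e` of `G`, where `Δ` is the maximum degree of `G`. -/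
def IsDeltaCritical [Fintype V] (G : SimpleGraph V) [DecidableRel G.Adj] : Prop :=
  G.Connected ∧ chromIndex G = G.maxDegree + 1 ∧
    ∀ e ∈ G.edgeSet, chromIndex (G.deleteEdges {e}) = G.maxDegree

/-- The independence number of `G`. -/
noncomputable def indepNum [Fintype V] (G : SimpleGraph V) : ℕ :=
  sSup {n | ∃ s : Finset V, (∀ u ∈ s, ∀ v ∈ s, u ≠ v → ¬ G.Adj u v) ∧ s.card = n}

structure Col (G : SimpleGraph V) (D : ℕ) (x y : V) (φ : V → V → ℕ) : Prop where
  symm : ∀ u v, φ u v = φ v u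
  le : ∀ u v, φ u v ≤ D
  inj : ∀ v a b, φ v a = φ v b → φ v a ≠ 0 → a = b
  supp : ∀ u v, φ u v ≠ 0 ↔ (G.Adj u v ∧ ¬(u = x ∧ v = y) ∧ ¬(u = y ∧ v = x))

def Mis (D : ℕ) (φ : V → V → ℕ) (v : V) (a : ℕ) : Prop :=
  a ≠ 0 ∧ a ≤ D ∧ ∀ u, φ v u ≠ a

def NC (G : SimpleGraph V) (D : ℕ) : Prop :=
  ∀ x y φ, G.Adj x y → Col G D x y φ → ∀ a, Mis D φ x a → Mis D φ y a → False

lemma Col.flip {G : SimpleGraph V} {D : ℕ} {x y : V} {φ : V → V → ℕ} (h : Col G D x y φ) :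
    Col G D y x φ := by
  refine ⟨h.symm, h.le, h.inj, fun u v => ?_⟩
  rw [h.supp]; tauto

def KG (φ : V → V → ℕ) (a b : ℕ) : SimpleGraph V :=
  SimpleGraph.fromRel (fun u v => φ u v = a ∨ φ u v = b)

lemma KG_congr {φ ψ : V → V → ℕ} {a b : ℕ} (ha : ∀ u v, φ u v = a ↔ ψ u v = a)
    (hb : ∀ u v, φ u v = b ↔ ψ u v = b) : KG φ a b = KG ψ a b := by
  unfold KG
  congr 1
  funext u v
  rw [ha, hb]

open Classical in
lemma three_ends_aux [Fintype V] (K : SimpleGraph V) (hdeg : ∀ v, K.degree v ≤ 2)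
    (u v w : V) (huv : u ≠ v) (huw : u ≠ w) (hvw : v ≠ w)
    (hu : K.degree u ≤ 1) (hv : K.degree v ≤ 1) (hw : K.degree w ≤ 1)
    (r1 : K.Reachable u v) (r2 : K.Reachable u w) : False := by
  set C := K.connectedComponentMk u with hC
  have hconn : C.toSimpleGraph.Connected := C.connected_toSimpleGraph
  have h1 := hconn.card_vert_le_card_edgeSet_add_one
  have h2 := C.toSimpleGraph.sum_degrees_eq_twice_card_edges
  have hd : ∀ p : C, C.toSimpleGraph.degree p = K.degree p.1 := by
    intro p
    rw [← SimpleGraph.card_neighborFinset_eq_degree, ← SimpleGraph.card_neighborFinset_eq_degree]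
    refine Finset.card_bij (fun q _ => q.1) ?_ ?_ ?_
    · intro q hq
      rw [SimpleGraph.mem_neighborFinset] at hq ⊢
      exact hq
    · intro q _ q' _ h
      exact Subtype.ext h
    · intro q hq
      have hadj : K.Adj p.1 q := by simpa using hq
      have hqC : q ∈ C.supp := by
        have := p.2
        change p.1 ∈ C.supp at this
        rw [SimpleGraph.ConnectedComponent.mem_supp_iff] at this ⊢
        rw [← this]
        exact SimpleGraph.ConnectedComponent.sound hadj.symm.reachable
      exact ⟨⟨q, hqC⟩, by rw [SimpleGraph.mem_neighborFinset]; exact hadj, rfl⟩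
  have hmem : ∀ q, K.Reachable u q → q ∈ C.supp := by
    intro q hq
    rw [SimpleGraph.ConnectedComponent.mem_supp_iff]
    exact SimpleGraph.ConnectedComponent.sound hq.symm
  let u' : C := ⟨u, hmem u (SimpleGraph.Reachable.refl u)⟩
  let v' : C := ⟨v, hmem v r1⟩
  let w' : C := ⟨w, hmem w r2⟩
  have h3 : ∑ p : C, C.toSimpleGraph.degree p + 3 ≤ ∑ p : C, 2 := by
    have e : ∀ p : C, C.toSimpleGraph.degree p +
        (if p ∈ ({u', v', w'} : Finset C) then 1 else 0) ≤ 2 := by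
      intro p
      rw [hd]
      split_ifs with h
      · simp only [Finset.mem_insert, Finset.mem_singleton] at h
        rcases h with rfl | rfl | rfl
        · exact Nat.succ_le_succ hu
        · exact Nat.succ_le_succ hv
        · exact Nat.succ_le_succ hw
      · exact hdeg _
    have := Finset.sum_le_sum (s := Finset.univ) (fun p _ => e p)
    rw [Finset.sum_add_distrib] at this
    have h4 : ∑ p : C, (if p ∈ ({u', v', w'} : Finset C) then 1 else 0) = 3 := by
      rw [Finset.sum_boole]
      simp only [Finset.filter_univ_mem, Nat.cast_id]
      rw [Finset.card_eq_three]
      exact ⟨u', v', w', by simpa [u', v'] using huv, by simpa [u', w'] using huw,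
        by simpa [v', w'] using hvw, rfl⟩
    rw [h4] at this
    exact this
  simp only [Finset.sum_const, Finset.card_univ, smul_eq_mul] at h3
  rw [h2] at h3
  rw [Nat.card_eq_fintype_card, Nat.card_eq_fintype_card, ← SimpleGraph.edgeFinset_card] at h1
  omega

open Classical in
lemma KG_degree [Fintype V] {G : SimpleGraph V} {D : ℕ} {x y : V} {φ : V → V → ℕ}
    (h : Col G D x y φ) {a b : ℕ} (ha : a ≠ 0) (hb : b ≠ 0) (v : V) :
    (KG φ a b).degree v ≤ 2 ∧ ((∀ u, φ v u ≠ a) ∨ (∀ u, φ v u ≠ b) → (KG φ a b).degree v ≤ 1) := by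
  have key : ∀ c, c ≠ 0 → (Finset.univ.filter (fun u => φ v u = c)).card ≤ 1 := by
    intro c hc
    rw [Finset.card_le_one]
    intro p hp q hq
    simp only [Finset.mem_filter, Finset.mem_univ, true_and] at hp hq
    exact h.inj v p q (by rw [hp, hq]) (by rw [hp]; exact hc)
  have sub : (KG φ a b).neighborFinset v ⊆ (Finset.univ.filter (fun u => φ v u = a)) ∪
      (Finset.univ.filter (fun u => φ v u = b)) := by
    intro q hq
    rw [SimpleGraph.mem_neighborFinset, KG, SimpleGraph.fromRel_adj] at hq
    have := h.symm q v
    simp only [Finset.mem_union, Finset.mem_filter, Finset.mem_univ, true_and]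
    rcases hq.2 with h' | h'
    · exact h'
    · rw [this] at h'; exact h'
  have c1 := (Finset.card_le_card sub).trans (Finset.card_union_le _ _)
  rw [SimpleGraph.card_neighborFinset_eq_degree] at c1
  have ka := key a ha
  have kb := key b hb
  refine ⟨by omega, ?_⟩
  rintro (h' | h')
  · have : (Finset.univ.filter (fun u => φ v u = a)).card = 0 := by
      simp [h']
    omega
  · have : (Finset.univ.filter (fun u => φ v u = b)).card = 0 := by
      simp [h']
    omega

lemma three_ends [Fintype V] {G : SimpleGraph V} {D : ℕ} {x y : V} {φ : V → V → ℕ}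
    (h : Col G D x y φ) {a b : ℕ} (ha : a ≠ 0) (hb : b ≠ 0) {u v w : V}
    (huv : u ≠ v) (huw : u ≠ w) (hvw : v ≠ w)
    (hu : (∀ p, φ u p ≠ a) ∨ (∀ p, φ u p ≠ b)) (hv : (∀ p, φ v p ≠ a) ∨ (∀ p, φ v p ≠ b))
    (hw : (∀ p, φ w p ≠ a) ∨ (∀ p, φ w p ≠ b))
    (r1 : (KG φ a b).Reachable u v) (r2 : (KG φ a b).Reachable u w) : False := by
  classical
  exact three_ends_aux (KG φ a b) (fun v => (KG_degree h ha hb v).1) u v w huv huw hvw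
    ((KG_degree h ha hb u).2 hu) ((KG_degree h ha hb v).2 hv) ((KG_degree h ha hb w).2 hw) r1 r2

open Classical in
noncomputable def swapC (φ : V → V → ℕ) (a b : ℕ) (r : V) : V → V → ℕ :=
  fun u v => if (KG φ a b).Reachable r u then Equiv.swap a b (φ u v) else φ u v

lemma reach_iff {φ : V → V → ℕ} {a b : ℕ} (r : V) {u v : V}
    (h : φ u v = a ∨ φ u v = b) : (KG φ a b).Reachable r u ↔ (KG φ a b).Reachable r v := by
  by_cases huv : u = v
  · rw [huv]
  have hadj : (KG φ a b).Adj u v := by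
    rw [KG, SimpleGraph.fromRel_adj]
    exact ⟨huv, Or.inl h⟩
  exact ⟨fun q => q.trans hadj.reachable, fun q => q.trans hadj.symm.reachable⟩

lemma swapC_eq {φ : V → V → ℕ} {a b c : ℕ} (hca : c ≠ a) (hcb : c ≠ b) (r u v : V) :
    swapC φ a b r u v = c ↔ φ u v = c := by
  unfold swapC
  split_ifs
  · constructor
    · intro h
      have : φ u v = Equiv.swap a b c := by rw [← h]; simp
      rw [this, Equiv.swap_apply_of_ne_of_ne hca hcb]
    · intro h
      rw [h, Equiv.swap_apply_of_ne_of_ne hca hcb]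
  · rfl

lemma swapC_col {G : SimpleGraph V} {D : ℕ} {x y : V} {φ : V → V → ℕ}
    (h : Col G D x y φ) {a b : ℕ} (ha : a ≠ 0) (hb : b ≠ 0) (haD : a ≤ D) (hbD : b ≤ D) (r : V) :
    Col G D x y (swapC φ a b r) := by
  refine ⟨?_, ?_, ?_, ?_⟩
  · intro u v
    by_cases hc : φ u v = a ∨ φ u v = b
    · have := reach_iff r hc
      unfold swapC
      rw [this, h.symm]
    · push Not at hc
      have e1 := (swapC_eq (φ := φ) hc.1 hc.2 r u v).2 rfl
      have e2 := (swapC_eq (φ := φ) hc.1 hc.2 r v u).2 (h.symm v u)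
      rw [e1, e2]
  · intro u v
    unfold swapC
    have := h.le u v
    split_ifs
    · rw [Equiv.swap_apply_def]; split_ifs <;> assumption
    · exact this
  · intro v p q he h0
    have h0' : φ v p ≠ 0 := by
      intro hz
      exact h0 ((swapC_eq ha.symm hb.symm r v p).2 hz)
    refine h.inj v p q ?_ h0'
    unfold swapC at he
    split_ifs at he
    · exact (Equiv.swap a b).injective he
    · exact he
  · intro u v
    rw [← h.supp]
    exact not_congr (swapC_eq ha.symm hb.symm r u v)

lemma swapC_mis_ne {D : ℕ} {φ : V → V → ℕ} {a b c : ℕ} (hca : c ≠ a) (hcb : c ≠ b) (r u : V) :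
    Mis D (swapC φ a b r) u c ↔ Mis D φ u c := by
  unfold Mis
  simp only [ne_eq, swapC_eq hca hcb]

lemma swapC_mis_out {D : ℕ} {φ : V → V → ℕ} {a b c : ℕ} {r u : V}
    (hu : ¬ (KG φ a b).Reachable r u) :
    Mis D (swapC φ a b r) u c ↔ Mis D φ u c := by
  unfold Mis
  have : ∀ v, swapC φ a b r u v = φ u v := fun v => by unfold swapC; rw [if_neg hu]
  simp only [this]

lemma swapC_mis_in {D : ℕ} {φ : V → V → ℕ} {a b : ℕ} {r u : V} (hb : b ≠ 0) (hbD : b ≤ D)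
    (hu : (KG φ a b).Reachable r u) (h : Mis D φ u a) :
    Mis D (swapC φ a b r) u b := by
  refine ⟨hb, hbD, fun v => ?_⟩
  have : swapC φ a b r u v = Equiv.swap a b (φ u v) := by unfold swapC; rw [if_pos hu]
  rw [this]
  intro h'
  apply h.2.2 v
  exact (Equiv.swap a b).injective (h'.trans (Equiv.swap_apply_left a b).symm)

lemma swapC_mis_in' {D : ℕ} {φ : V → V → ℕ} {a b : ℕ} {r u : V} (ha : a ≠ 0) (haD : a ≤ D)
    (hu : (KG φ a b).Reachable r u) (h : Mis D φ u b) :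
    Mis D (swapC φ a b r) u a := by
  refine ⟨ha, haD, fun v => ?_⟩
  have : swapC φ a b r u v = Equiv.swap a b (φ u v) := by unfold swapC; rw [if_pos hu]
  rw [this]
  intro h'
  apply h.2.2 v
  exact (Equiv.swap a b).injective (h'.trans (Equiv.swap_apply_right a b).symm)

open Classical in
noncomputable def setE (φ : V → V → ℕ) (u v : V) (a : ℕ) : V → V → ℕ :=
  fun p q => if (p = u ∧ q = v) ∨ (p = v ∧ q = u) then a else φ p q

/-- shifting the uncoloured edge from `x y` to `y z` -/
lemma shift_col {G : SimpleGraph V} {D : ℕ} {x y z : V} {φ : V → V → ℕ}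
    (hxy : G.Adj x y) (h : Col G D x y φ) {j : ℕ} (hj : φ y z = j) (hm : Mis D φ x j) :
    Col G D y z (setE (setE φ y z 0) x y j) := by
  have hne := hxy.ne
  obtain ⟨h0, hD, hm⟩ := hm
  have h1 := (h.supp y z).1 (by rw [hj]; exact h0)
  have hyz := h1.1.ne
  have hxz : z ≠ x := by rintro rfl; tauto
  refine ⟨?_, ?_, ?_, ?_⟩
  · intro u v
    have := h.symm u v
    unfold setE
    grind
  · intro u v
    have := h.le u v
    unfold setE
    grind
  · intro v p q
    have e1 := h.inj v p q
    have e2 := h.inj y z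
    have e4 := h.symm
    unfold setE
    grind
  · intro u v
    have := h.supp u v
    have e2 := hxy.symm
    unfold setE
    grind

lemma recolor_col {G : SimpleGraph V} {D : ℕ} {x y z : V} {φ : V → V → ℕ}
    (h : Col G D x y φ) {a : ℕ} (hj : φ y z ≠ 0) (hm : Mis D φ y a) (hz : Mis D φ z a) :
    Col G D x y (setE φ y z a) := by
  obtain ⟨h0, hD, hm⟩ := hm
  have hz := hz.2.2
  have h1 := (h.supp y z).1 hj
  have hyz := h1.1.ne
  refine ⟨?_, ?_, ?_, ?_⟩
  · intro u v
    have := h.symm u v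
    unfold setE
    grind
  · intro u v
    have := h.le u v
    unfold setE
    grind
  · intro v p q
    have e1 := h.inj v p q
    unfold setE
    grind
  · intro u v
    have := h.supp u v
    have e2 := h1.1.symm
    unfold setE
    grind

lemma setE_eq {φ : V → V → ℕ} {u v : V} {a c : ℕ} (hs : ∀ u v, φ u v = φ v u) (hca : c ≠ a)
    (hcu : c ≠ φ u v) (p q : V) : setE φ u v a p q = c ↔ φ p q = c := by
  have := hs p q
  unfold setE
  grind

section core
variable {G : SimpleGraph V} {D : ℕ}

lemma chain_xy (hnc : NC G D) {x y : V} {φ : V → V → ℕ} (hxy : G.Adj x y) (h : Col G D x y φ)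
    {a g : ℕ} (ha : Mis D φ y a) (hg : Mis D φ x g) : (KG φ a g).Reachable y x := by
  by_contra hr
  have h' := swapC_col h ha.1 hg.1 ha.2.1 hg.2.1 y
  refine hnc x y _ hxy h' g ?_ ?_
  · rw [swapC_mis_out hr]; exact hg
  · exact swapC_mis_in hg.1 hg.2.1 (SimpleGraph.Reachable.refl y) ha

lemma fan3 [Fintype V] (hnc : NC G D) {x y z : V} {φ : V → V → ℕ} (hxy : G.Adj x y)
    (h : Col G D x y φ) {a g e : ℕ} (ha : Mis D φ y a) (hz : φ y z = g) (hg : Mis D φ x g)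
    (he : Mis D φ x e) (hze : Mis D φ z e) : False := by
  have h' := shift_col hxy h hz hg
  have hag : a ≠ g := fun q => hnc x y φ hxy h a (q ▸ hg) ha
  have hae : a ≠ e := fun q => hnc x y φ hxy h a (q ▸ he) ha
  have heg : e ≠ g := by rintro rfl; exact hze.2.2 y (by rw [h.symm]; exact hz)
  have h1 := (h.supp y z).1 (by rw [hz]; exact hg.1)
  have hyz := h1.1.ne
  have hxz : z ≠ x := by rintro rfl; tauto
  have hxy0 : φ x y = 0 := by
    by_contra hc
    have := (h.supp x y).1 hc
    tauto
  have key : ∀ c, c ≠ 0 → c ≠ g → ∀ u v,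
      setE (setE φ y z 0) x y g u v = c ↔ φ u v = c := by
    intro c h0 hc u v
    have := h.symm u v
    have h2 := h.symm x y
    unfold setE
    have := hxy.ne
    grind
  have ma : Mis D (setE (setE φ y z 0) x y g) y a :=
    ⟨ha.1, ha.2.1, fun u => by rw [ne_eq, key a ha.1 hag]; exact ha.2.2 u⟩
  have mz : Mis D (setE (setE φ y z 0) x y g) z e :=
    ⟨he.1, he.2.1, fun u => by rw [ne_eq, key e he.1 heg]; exact hze.2.2 u⟩
  have r1 := chain_xy hnc h1.1.symm h'.flip ma mz
  rw [KG_congr (key a ha.1 hag) (key e he.1 heg)] at r1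
  have r2 := chain_xy hnc hxy h ha he
  exact three_ends h ha.1 he.1 hyz hxy.ne.symm hxz (Or.inl ha.2.2) (Or.inr hze.2.2)
    (Or.inr he.2.2) r1 r2

lemma low_chain [Fintype V] (hnc : NC G D) {x y z : V} {φ : V → V → ℕ} (hxy : G.Adj x y)
    (h : Col G D x y φ) {a j g e : ℕ} (ha : Mis D φ y a) (hz : φ y z = j) (hj : j ≠ 0)
    (hg : Mis D φ x g) (he : Mis D φ x e) (hge : g ≠ e) (hzg : Mis D φ z g) (hze : Mis D φ z e) :
    (KG φ j g).Reachable x z := by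
  by_contra hr
  have hr' : ¬ (KG φ j g).Reachable z x := fun q => hr q.symm
  have hzy : φ z y = j := by rw [h.symm]; exact hz
  have hjD : j ≤ D := hz ▸ h.le y z
  have hjg : j ≠ g := fun q => hzg.2.2 y (by rw [hzy, q])
  have hje : j ≠ e := fun q => hze.2.2 y (by rw [hzy, q])
  have haj : a ≠ j := fun q => ha.2.2 z (by rw [hz, q])
  have hag : a ≠ g := fun q => hnc x y φ hxy h a (q ▸ hg) ha
  have h' := swapC_col h hj hg.1 hjD hg.2.1 z
  have hry : (KG φ j g).Reachable z y :=
    (reach_iff z (Or.inl hzy)).1 (SimpleGraph.Reachable.refl z)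
  refine fan3 hnc hxy h' (a := a) (g := g) (e := e) (z := z) ?_ ?_ ?_ ?_ ?_
  · rw [swapC_mis_ne haj hag]; exact ha
  · unfold swapC
    rw [if_pos hry, hz, Equiv.swap_apply_left]
  · rw [swapC_mis_out hr']; exact hg
  · rw [swapC_mis_out hr']; exact he
  · rw [swapC_mis_ne hje.symm hge.symm]; exact hze

lemma mate [Fintype V] (hnc : NC G D) {x y0 z y : V} {φ : V → V → ℕ} (hxy : G.Adj x y0)
    (h : Col G D x y0 φ) {a j k : ℕ} (ha : Mis D φ y0 a) (hz : φ y0 z = j) (hj : j ≠ 0)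
    (hk : Mis D φ x k) (hzk : Mis D φ z k) (hy : φ x y = j) :
    ∃ ψ, Col G D x y ψ ∧ Mis D ψ y j ∧
      ∀ c, c ≠ 0 → c ≠ a → c ≠ k → c ≠ j → ∀ u v, ψ u v = c ↔ φ u v = c := by
  have hxy0 : φ x y0 = 0 := by
    by_contra hc
    have := (h.supp x y0).1 hc
    tauto
  have hyx0 : φ y0 x = 0 := by rw [h.symm]; exact hxy0
  have hzx : z ≠ x := by rintro rfl; rw [hyx0] at hz; exact hj hz.symm
  have hzy : z ≠ y0 := ((h.supp y0 z).1 (by rw [hz]; exact hj)).1.ne.symm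
  have hyy : y ≠ y0 := by rintro rfl; rw [hxy0] at hy; exact hj hy.symm
  have hxyj := (h.supp x y).1 (by rw [hy]; exact hj)
  have hxy1 := hxyj.1.ne
  have haj : a ≠ j := fun q => ha.2.2 z (by rw [hz, q])
  have hak : a ≠ k := fun q => hnc x y0 φ hxy h a (q ▸ hk) ha
  have r2 := chain_xy hnc hxy h ha hk
  have hzx' : ¬ (KG φ a k).Reachable z x := fun q =>
    three_ends h ha.1 hk.1 hxy.ne hzx.symm hzy.symm (Or.inr hk.2.2) (Or.inl ha.2.2)
      (Or.inr hzk.2.2) r2.symm q.symm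
  have hzy' : ¬ (KG φ a k).Reachable z y0 := fun q => hzx' (q.trans r2)
  have h1 := swapC_col h ha.1 hk.1 ha.2.1 hk.2.1 z
  have hk1 : ∀ c, c ≠ a → c ≠ k → ∀ u v, swapC φ a k z u v = c ↔ φ u v = c :=
    fun c h1 h2 u v => swapC_eq h1 h2 z u v
  have hx1 : ∀ v, swapC φ a k z x v = φ x v := fun v => by unfold swapC; rw [if_neg hzx']
  have hy1 : ∀ v, swapC φ a k z y0 v = φ y0 v := fun v => by unfold swapC; rw [if_neg hzy']
  have mz : Mis D (swapC φ a k z) z a :=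
    swapC_mis_in' ha.1 ha.2.1 (SimpleGraph.Reachable.refl z) hzk
  generalize swapC φ a k z = φ1 at *
  have my : Mis D φ1 y0 a := ⟨ha.1, ha.2.1, fun u => by rw [hy1]; exact ha.2.2 u⟩
  have h2 := recolor_col h1 (by rw [hy1, hz]; exact hj) my mz
  have my2 : Mis D (setE φ1 y0 z a) y0 j := by
    refine ⟨hj, hz ▸ h.le y0 z, fun u => ?_⟩
    have := h.inj y0 u z
    have := hy1 u
    unfold setE
    grind
  have e2 : setE φ1 y0 z a x y = j := by
    have := hx1 y
    unfold setE
    have := hxy.ne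
    grind
  have hk2 : ∀ c, c ≠ a → c ≠ j → ∀ u v, setE φ1 y0 z a u v = c ↔ φ1 u v = c :=
    fun c h3 h4 u v => setE_eq h1.symm h3 (by rw [hy1, hz]; exact h4) u v
  have hx2 : setE φ1 y0 z a y0 x = 0 := by
    by_contra hc
    have := (h2.supp y0 x).1 hc
    tauto
  generalize setE φ1 y0 z a = φ2 at *
  have h3 := shift_col hxy.symm h2.flip e2 my2
  refine ⟨_, h3, ?_, ?_⟩
  · refine ⟨hj, hz ▸ h.le y0 z, fun u => ?_⟩
    have := h2.inj y u x
    have := h2.symm x y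
    unfold setE
    grind
  · intro c c0 ca ck cj u v
    rw [← hk1 c ca ck, ← hk2 c ca cj]
    have := h2.symm u v
    have := h2.symm x y
    have := h2.symm y0 x
    unfold setE
    grind

lemma row_chain [Fintype V] (hnc : NC G D) {x y0 z y w : V} {φ : V → V → ℕ} (hxy : G.Adj x y0)
    (h : Col G D x y0 φ) {a j k k1 k2 l : ℕ} (ha : Mis D φ y0 a) (hz : φ y0 z = j) (hj : j ≠ 0)
    (hk : Mis D φ x k) (hzk : Mis D φ z k) (hy : φ x y = j)
    (hw : φ y w = l) (hl : l ≠ 0) (hla : l ≠ a) (hlk : l ≠ k) (hlj : l ≠ j)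
    (hk1 : Mis D φ x k1) (hk2 : Mis D φ x k2) (hw1 : Mis D φ w k1) (hw2 : Mis D φ w k2)
    (n1 : k1 ≠ k) (n2 : k2 ≠ k) (n12 : k1 ≠ k2) :
    ¬ Mis D φ x l ∧ (KG φ l k1).Reachable x w := by
  obtain ⟨ψ, hψ, my, hc⟩ := mate hnc hxy h ha hz hj hk hzk hy
  have hadj := ((h.supp x y).1 (by rw [hy]; exact hj)).1
  have n1j : k1 ≠ j := fun q => hk1.2.2 y (by rw [hy, q])
  have n2j : k2 ≠ j := fun q => hk2.2.2 y (by rw [hy, q])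
  have n1a : k1 ≠ a := fun q => hnc x y0 φ hxy h a (q ▸ hk1) ha
  have n2a : k2 ≠ a := fun q => hnc x y0 φ hxy h a (q ▸ hk2) ha
  have tr : ∀ c, c ≠ a → c ≠ k → c ≠ j → ∀ u, Mis D φ u c → Mis D ψ u c := by
    intro c c1 c2 c3 u hm
    exact ⟨hm.1, hm.2.1, fun v => by rw [ne_eq, hc c hm.1 c1 c2 c3]; exact hm.2.2 v⟩
  have hw' : ψ y w = l := by rw [hc l hl hla hlk hlj]; exact hw
  constructor
  · intro hm
    exact fan3 hnc hadj hψ my hw' (tr l hla hlk hlj x hm) (tr k1 n1a n1 n1j x hk1)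
      (tr k1 n1a n1 n1j w hw1)
  · have := low_chain hnc hadj hψ my hw' hl (tr k1 n1a n1 n1j x hk1) (tr k2 n2a n2 n2j x hk2) n12
      (tr k1 n1a n1 n1j w hw1) (tr k2 n2a n2 n2j w hw2)
    rwa [KG_congr (hc l hl hla hlk hlj) (hc k1 hk1.1 n1a n1 n1j)] at this

/-- moving a colour `k` into the set of colours missing at `x` -/
lemma swap_in [Fintype V] (hnc : NC G D) {x y0 : V} {φ : V → V → ℕ} (hxy : G.Adj x y0)
    (h : Col G D x y0 φ) {a k g : ℕ} (ha : Mis D φ y0 a) (hka : k ≠ a) (hk0 : k ≠ 0) (hkD : k ≤ D)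
    (hg : Mis D φ x g) :
    ∃ ψ w0, Col G D x y0 ψ ∧ Mis D ψ y0 a ∧ Mis D ψ x k ∧
      (∀ c, c ≠ k → c ≠ g → ∀ u v, ψ u v = c ↔ φ u v = c) ∧
      (∀ w, w ≠ w0 → Mis D φ w k → Mis D ψ w k) := by
  have hag : a ≠ g := fun q => hnc x y0 φ hxy h a (q ▸ hg) ha
  by_cases hkx : Mis D φ x k
  · exact ⟨φ, x, h, ha, hkx, fun c _ _ u v => Iff.rfl, fun w _ hm => hm⟩
  have h' := swapC_col h hk0 hg.1 hkD hg.2.1 x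
  have hex : ∃ w0, ∀ w, w ≠ w0 → Mis D φ w k → ¬ (KG φ k g).Reachable x w := by
    by_cases hh : ∃ w0, Mis D φ w0 k ∧ (KG φ k g).Reachable x w0
    · obtain ⟨w0, hw0, hr0⟩ := hh
      refine ⟨w0, fun w hw hm hr => ?_⟩
      have e0 : x ≠ w0 := by rintro rfl; exact hkx hw0
      have e1 : x ≠ w := by rintro rfl; exact hkx hm
      exact three_ends h hk0 hg.1 e0 e1 hw.symm (Or.inr hg.2.2) (Or.inl hw0.2.2)
        (Or.inl hm.2.2) hr0 hr
    · push Not at hh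
      exact ⟨x, fun w _ hm => hh w hm⟩
  obtain ⟨w0, hw0⟩ := hex
  refine ⟨_, w0, h', ?_, ?_, ?_, ?_⟩
  · rw [swapC_mis_ne hka.symm hag]; exact ha
  · exact swapC_mis_in' hk0 hkD (SimpleGraph.Reachable.refl x) hg
  · exact fun c c1 c2 u v => swapC_eq c1 c2 x u v
  · intro w hw hm
    rw [swapC_mis_out (hw0 w hw hm)]; exact hm

end core

section counting
set_option linter.unusedSectionVars false
variable {G : SimpleGraph V} {D : ℕ}

open Classical in
noncomputable def misF (D : ℕ) (φ : V → V → ℕ) (v : V) : Finset ℕ :=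
  (Finset.Icc 1 D).filter (fun c => Mis D φ v c)

open Classical in
noncomputable def prF (D : ℕ) (φ : V → V → ℕ) (v : V) : Finset ℕ :=
  (Finset.Icc 1 D).filter (fun c => ¬ Mis D φ v c)

lemma mem_misF {φ : V → V → ℕ} {v : V} {c : ℕ} : c ∈ misF D φ v ↔ Mis D φ v c := by
  classical
  unfold misF
  rw [Finset.mem_filter, Finset.mem_Icc]
  constructor
  · exact fun h => h.2
  · exact fun h => ⟨⟨Nat.one_le_iff_ne_zero.2 h.1, h.2.1⟩, h⟩

lemma mem_prF {φ : V → V → ℕ} {v : V} {c : ℕ} :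
    c ∈ prF D φ v ↔ (c ≠ 0 ∧ c ≤ D) ∧ ¬ Mis D φ v c := by
  classical
  unfold prF
  rw [Finset.mem_filter, Finset.mem_Icc, Nat.one_le_iff_ne_zero]

lemma misF_add_prF (φ : V → V → ℕ) (v : V) : (misF D φ v).card + (prF D φ v).card = D := by
  unfold misF prF
  rw [Finset.card_filter_add_card_filter_not]
  simp

lemma exists_of_not_mis {φ : V → V → ℕ} {v : V} {c : ℕ} (h0 : c ≠ 0) (hD : c ≤ D)
    (h : ¬ Mis D φ v c) : ∃ u, φ v u = c := by
  unfold Mis at h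
  push Not at h
  exact h h0 hD

variable [Fintype V] [DecidableRel G.Adj]

lemma prF_card {x y : V} {φ : V → V → ℕ} (h : Col G D x y φ) (v : V) :
    (prF D φ v).card ≤ G.degree v := by
  classical
  have : prF D φ v ⊆ (G.neighborFinset v).image (fun u => φ v u) := by
    intro c hc
    rw [mem_prF] at hc
    obtain ⟨u, hu⟩ := exists_of_not_mis hc.1.1 hc.1.2 hc.2
    rw [Finset.mem_image]
    refine ⟨u, ?_, hu⟩
    rw [SimpleGraph.mem_neighborFinset]
    exact ((h.supp v u).1 (by rw [hu]; exact hc.1.1)).1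
  exact (Finset.card_le_card this).trans (Finset.card_image_le.trans
    (by rw [SimpleGraph.card_neighborFinset_eq_degree]))

lemma prF_card_end {x y : V} {φ : V → V → ℕ} (hxy : G.Adj x y) (h : Col G D x y φ) :
    (prF D φ x).card + 1 ≤ G.degree x := by
  classical
  have : prF D φ x ⊆ ((G.neighborFinset x).erase y).image (fun u => φ x u) := by
    intro c hc
    rw [mem_prF] at hc
    obtain ⟨u, hu⟩ := exists_of_not_mis hc.1.1 hc.1.2 hc.2
    rw [Finset.mem_image]
    refine ⟨u, ?_, hu⟩
    have := (h.supp x u).1 (by rw [hu]; exact hc.1.1)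
    rw [Finset.mem_erase, SimpleGraph.mem_neighborFinset]
    exact ⟨by rintro rfl; tauto, this.1⟩
  have h1 := (Finset.card_le_card this).trans Finset.card_image_le
  have h2 := Finset.card_erase_add_one ((SimpleGraph.mem_neighborFinset G x y).2 hxy)
  rw [SimpleGraph.card_neighborFinset_eq_degree] at h2
  omega

lemma exists_mis_end (hD : ∀ v, G.degree v ≤ D) {x y : V} {φ : V → V → ℕ} (hxy : G.Adj x y)
    (h : Col G D x y φ) : ∃ a, Mis D φ y a := by
  have h1 := prF_card_end hxy.symm h.flip
  have h2 := misF_add_prF (D := D) φ y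
  have h3 := hD y
  have : (misF D φ y).Nonempty := by
    rw [← Finset.card_pos]; omega
  obtain ⟨a, ha⟩ := this
  exact ⟨a, mem_misF.1 ha⟩

lemma pairs_card (hnc : NC G D) {x y0 : V} {φ : V → V → ℕ} (hxy : G.Adj x y0)
    (h : Col G D x y0 φ) {a k1 : ℕ} (ha : Mis D φ y0 a) (hk1 : Mis D φ x k1)
    (Q : Finset (V × V)) (hQ : ∀ p ∈ Q, φ p.1 p.2 ≠ 0 ∧ φ p.1 p.2 ≠ a ∧ p.2 ≠ x ∧
      Mis D φ p.2 k1 ∧ ¬ Mis D φ x (φ p.1 p.2) ∧ (KG φ (φ p.1 p.2) k1).Reachable x p.2) :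
    Q.card + 2 ≤ G.degree x := by
  have haP : a ∈ prF D φ x := by
    rw [mem_prF]
    exact ⟨⟨ha.1, ha.2.1⟩, fun q => hnc x y0 φ hxy h a q ha⟩
  have h1 := Finset.card_erase_add_one haP
  have h2 := prF_card_end hxy h
  have h3 : Q.card ≤ ((prF D φ x).erase a).card := by
    refine Finset.card_le_card_of_injOn (fun p => φ p.1 p.2) ?_ ?_
    · intro p hp
      have := hQ p hp
      simp only [Finset.coe_erase, Set.mem_sdiff, Finset.mem_coe, Set.mem_singleton_iff, mem_prF]
      exact ⟨⟨⟨this.1, h.le _ _⟩, this.2.2.2.2.1⟩, this.2.1⟩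
    · intro p hp q hq he
      have e1 := hQ p hp
      have e2 := hQ q hq
      simp only at he
      have hw : p.2 = q.2 := by
        by_contra hne
        refine three_ends h e1.1 hk1.1 e1.2.2.1.symm e2.2.2.1.symm hne (Or.inr hk1.2.2)
          (Or.inr e1.2.2.2.1.2.2) (Or.inr e2.2.2.2.1.2.2) e1.2.2.2.2.2 ?_
        rw [he]; exact e2.2.2.2.2.2
      have : p.1 = q.1 := by
        apply h.inj p.2 p.1 q.1
        · rw [h.symm, he, h.symm, hw]
        · rw [h.symm]; exact e1.1
      exact Prod.ext this hw
  omega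

open Classical in
noncomputable def lowN (G : SimpleGraph V) [DecidableRel G.Adj] (T : ℕ) (y : V) : Finset V :=
  (G.neighborFinset y).filter (fun z => G.degree z < T)

lemma mem_lowN {T : ℕ} {y z : V} : z ∈ lowN G T y ↔ G.Adj y z ∧ G.degree z < T := by
  unfold lowN
  rw [Finset.mem_filter, SimpleGraph.mem_neighborFinset]

lemma four_of_card {s : Finset ℕ} (h : 4 ≤ s.card) : ∃ a b c d, a ∈ s ∧ b ∈ s ∧ c ∈ s ∧ d ∈ s ∧
    a ≠ b ∧ a ≠ c ∧ a ≠ d ∧ b ≠ c ∧ b ≠ d ∧ c ≠ d := by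
  have : s.Nonempty := by rw [← Finset.card_pos]; omega
  obtain ⟨a, ha⟩ := this
  have h1 := Finset.card_erase_add_one ha
  have h2 : 2 < (s.erase a).card := by omega
  rw [Finset.two_lt_card] at h2
  obtain ⟨b, hb, c, hc, d, hd, h3⟩ := h2
  rw [Finset.mem_erase] at hb hc hd
  exact ⟨a, b, c, d, ha, hb.2, hc.2, hd.2, hb.1.symm, hc.1.symm, hd.1.symm, h3⟩

lemma color_ne_zero {x y0 y w : V} {φ : V → V → ℕ} (h : Col G D x y0 φ) (hadj : G.Adj y w)
    (hw : w ≠ x) (hyx : y ≠ x) : φ y w ≠ 0 := by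
  rw [h.supp]
  exact ⟨hadj, fun q => hyx q.1, fun q => hw q.2⟩

/-- the mates of the vertices in `Z` -/
lemma mates {x y0 : V} {φ : V → V → ℕ} (h : Col G D x y0 φ) (Z : Finset V)
    (hZ : ∀ z ∈ Z, φ y0 z ≠ 0 ∧ ¬ Mis D φ x (φ y0 z)) :
    ∃ R : Finset V, R.card = Z.card ∧ ∀ y ∈ R, G.Adj x y ∧ y ≠ y0 ∧ ∃ z ∈ Z, φ y0 z = φ x y := by
  classical
  have : ∀ z : Z, ∃ y, φ x y = φ y0 z := fun z =>
    exists_of_not_mis (hZ z z.2).1 (h.le _ _) (hZ z z.2).2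
  choose f hf using this
  refine ⟨Finset.univ.image f, ?_, ?_⟩
  · rw [Finset.card_image_of_injective]
    · simp
    · intro z z' he
      have e : φ y0 z = φ y0 z' := by rw [← hf, ← hf, he]
      exact Subtype.ext (h.inj y0 z z' e (hZ z z.2).1)
  · intro y hy
    rw [Finset.mem_image] at hy
    obtain ⟨z, _, rfl⟩ := hy
    have hne : φ x (f z) ≠ 0 := by rw [hf]; exact (hZ z z.2).1
    have := (h.supp x (f z)).1 hne
    refine ⟨this.1, ?_, z, z.2, (hf z).symm⟩
    intro q
    exact this.2.1 ⟨rfl, q⟩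

lemma low_rows (hnc : NC G D) (hcol : ∀ x y, G.Adj x y → ∃ φ, Col G D x y φ)
    (hD : ∀ v, G.degree v ≤ D) {s : ℕ} (hs : s ^ 3 + 2 * s + 4 ≤ D) {x y0 : V}
    (hx : G.degree x < s) (hxy : G.Adj x y0)
    (hmax : ∀ y, G.Adj x y → (lowN G s y).card ≤ (lowN G s y0).card) :
    ∃ R : Finset V, R ⊆ G.neighborFinset x ∧ R.card + 1 = (lowN G s y0).card ∧
      ∑ y ∈ R, (lowN G s y).card + 3 ≤ G.degree x + (lowN G s y0).card ∧
      (lowN G s y0).card + 1 ≤ G.degree x := by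
  classical
  obtain ⟨φ, h⟩ := hcol x y0 hxy
  obtain ⟨a, ha⟩ := exists_mis_end hD hxy h
  set Z := (lowN G s y0).erase x with hZdef
  have hxZ : x ∈ lowN G s y0 := mem_lowN.2 ⟨hxy.symm, hx⟩
  have hZc : Z.card + 1 = (lowN G s y0).card := Finset.card_erase_add_one hxZ
  have hPx := prF_card_end hxy h
  have hMx := misF_add_prF (D := D) φ x
  have hZ : ∀ z ∈ Z, φ y0 z ≠ 0 ∧ ¬ Mis D φ x (φ y0 z) := by
    intro z hz
    rw [hZdef, Finset.mem_erase, mem_lowN] at hz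
    refine ⟨color_ne_zero h hz.2.1 hz.1 hxy.ne.symm, fun hm => ?_⟩
    have hPz := prF_card h z
    have hc : 0 < (misF D φ x \ prF D φ z).card := by
      have := Finset.le_card_sdiff (prF D φ z) (misF D φ x)
      omega
    obtain ⟨e, he⟩ := Finset.card_pos.1 hc
    rw [Finset.mem_sdiff, mem_misF, mem_prF] at he
    refine fan3 hnc hxy h ha rfl hm he.1 ?_
    by_contra hq
    exact he.2 ⟨⟨he.1.1, he.1.2.1⟩, hq⟩
  have haP : a ∈ prF D φ x := by
    rw [mem_prF]
    exact ⟨⟨ha.1, ha.2.1⟩, fun q => hnc x y0 φ hxy h a q ha⟩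
  have hPe := Finset.card_erase_add_one haP
  have hZle : Z.card ≤ ((prF D φ x).erase a).card := by
    refine Finset.card_le_card_of_injOn (fun z => φ y0 z) ?_ ?_
    · intro z hz
      simp only [Finset.coe_erase, Set.mem_sdiff, Finset.mem_coe, Set.mem_singleton_iff, mem_prF]
      exact ⟨⟨⟨(hZ z hz).1, h.le _ _⟩, (hZ z hz).2⟩, ha.2.2 z⟩
    · intro z hz z' hz' he
      exact h.inj y0 z z' he (hZ z hz).1
  -- common missing colours
  set U := ((G.neighborFinset x).biUnion (fun y => lowN G s y)) with hU
  have hUc : U.card ≤ s * s := by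
    have : U.card ≤ (G.neighborFinset x).card * (lowN G s y0).card := by
      apply Finset.card_biUnion_le_card_mul
      intro y hy
      exact hmax y ((SimpleGraph.mem_neighborFinset G x y).1 hy)
    rw [SimpleGraph.card_neighborFinset_eq_degree] at this
    exact this.trans (Nat.mul_le_mul (by omega) (by omega))
  have hBc : (U.biUnion (fun z => prF D φ z)).card ≤ s * s * s := by
    refine (Finset.card_biUnion_le_card_mul U _ s ?_).trans (Nat.mul_le_mul_right s hUc)
    intro z hz
    rw [hU, Finset.mem_biUnion] at hz
    obtain ⟨y, _, hz⟩ := hz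
    have := (mem_lowN.1 hz).2
    exact (prF_card h z).trans this.le
  have h4 : 4 ≤ (misF D φ x \ U.biUnion (fun z => prF D φ z)).card := by
    have := Finset.le_card_sdiff (U.biUnion (fun z => prF D φ z)) (misF D φ x)
    have e : s ^ 3 = s * s * s := by ring
    omega
  obtain ⟨k, k', k1, k2, hk, hk', hk1, hk2, n1, n2, n3, n4, n5, n6⟩ := four_of_card h4
  have hkk : ∀ c ∈ (misF D φ x \ U.biUnion (fun z => prF D φ z)), Mis D φ x c ∧
      ∀ y, G.Adj x y → ∀ w ∈ lowN G s y, Mis D φ w c := by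
    intro c hc
    rw [Finset.mem_sdiff, mem_misF, Finset.mem_biUnion] at hc
    refine ⟨hc.1, fun y hy w hw => ?_⟩
    by_contra hq
    apply hc.2
    refine ⟨w, ?_, mem_prF.2 ⟨⟨hc.1.1, hc.1.2.1⟩, hq⟩⟩
    rw [hU, Finset.mem_biUnion]
    exact ⟨y, (SimpleGraph.mem_neighborFinset G x y).2 hy, hw⟩
  have hk := hkk k hk
  have hk' := hkk k' hk'
  have hk1 := hkk k1 hk1
  have hk2 := hkk k2 hk2
  obtain ⟨R, hRc, hR⟩ := mates h Z hZ
  have hy0R : y0 ∉ R := fun q => (hR y0 q).2.1 rfl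
  set S : V → Finset V := fun y => ((lowN G s y).erase x).filter (fun w => φ y w ≠ a) with hS
  set Q : Finset (V × V) := (insert y0 R).biUnion (fun y => (S y).image (fun w => (y, w))) with hQ
  have hQc : Q.card = ∑ y ∈ insert y0 R, (S y).card := by
    rw [hQ, Finset.card_biUnion]
    · refine Finset.sum_congr rfl (fun y _ => ?_)
      rw [Finset.card_image_of_injective]
      intro w w' he
      exact (Prod.ext_iff.1 he).2
    · intro y _ y' _ hne
      simp only [Function.onFun]
      rw [Finset.disjoint_left]
      intro p hp hp'
      rw [Finset.mem_image] at hp hp'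
      obtain ⟨w, _, rfl⟩ := hp
      obtain ⟨w', _, he⟩ := hp'
      exact hne (Prod.ext_iff.1 he).1.symm
  have hQ2 := pairs_card hnc hxy h ha hk1.1 Q (by
    intro p hp
    rw [hQ, Finset.mem_biUnion] at hp
    obtain ⟨y, hy, hp⟩ := hp
    rw [Finset.mem_image] at hp
    obtain ⟨w, hw, rfl⟩ := hp
    simp only
    simp only [hS, Finset.mem_filter, Finset.mem_erase] at hw
    obtain ⟨⟨hwx, hwl⟩, hwa⟩ := hw
    have hwadj := (mem_lowN.1 hwl).1
    rw [Finset.mem_insert] at hy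
    rcases hy with rfl | hy
    · have hwZ : w ∈ Z := by rw [hZdef, Finset.mem_erase]; exact ⟨hwx, hwl⟩
      refine ⟨(hZ w hwZ).1, hwa, hwx, hk1.2 _ hxy w hwl, (hZ w hwZ).2, ?_⟩
      exact low_chain hnc hxy h ha rfl (hZ w hwZ).1 hk1.1 hk2.1 n6 (hk1.2 _ hxy w hwl)
        (hk2.2 _ hxy w hwl)
    · obtain ⟨hxy', _, z, hz, hzy⟩ := hR y hy
      have hzl : z ∈ lowN G s y0 := (Finset.mem_erase.1 hz).2
      have hl0 := color_ne_zero h hwadj hwx hxy'.ne.symm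
      have hlj : φ y w ≠ φ y0 z := by
        rw [hzy, h.symm x y]
        intro q
        exact hwx (h.inj y w x q hl0)
      have key : ¬ Mis D φ x (φ y w) ∧ (KG φ (φ y w) k1).Reachable x w := by
        by_cases hlk : φ y w = k
        · exact row_chain hnc hxy h ha rfl (hZ z hz).1 hk'.1 (hk'.2 _ hxy z hzl) hzy.symm rfl hl0
            hwa (by rw [hlk]; exact n1) hlj hk1.1 hk2.1 (hk1.2 _ hxy' w hwl)
            (hk2.2 _ hxy' w hwl) n4.symm n5.symm n6
        · exact row_chain hnc hxy h ha rfl (hZ z hz).1 hk.1 (hk.2 _ hxy z hzl) hzy.symm rfl hl0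
            hwa hlk hlj hk1.1 hk2.1 (hk1.2 _ hxy' w hwl)
            (hk2.2 _ hxy' w hwl) n2.symm n3.symm n6
      exact ⟨hl0, hwa, hwx, hk1.2 _ hxy' w hwl, key.1, key.2⟩)
  rw [hQc, Finset.sum_insert hy0R] at hQ2
  have hS0 : (S y0).card = Z.card := by
    congr 1
    simp only [hS]
    rw [Finset.filter_true_of_mem]
    intro w _
    exact ha.2.2 w
  have hSy : ∀ y ∈ R, (lowN G s y).card ≤ (S y).card + 2 := by
    intro y hy
    have hxl : x ∈ lowN G s y := mem_lowN.2 ⟨(hR y hy).1.symm, hx⟩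
    have e1 := Finset.card_erase_add_one hxl
    have e2 := Finset.card_filter_add_card_filter_not (s := (lowN G s y).erase x)
      (fun w => φ y w ≠ a)
    have e3 : (((lowN G s y).erase x).filter (fun w => ¬ (φ y w ≠ a))).card ≤ 1 := by
      rw [Finset.card_le_one]
      intro p hp q hq
      rw [Finset.mem_filter, not_not] at hp hq
      exact h.inj y p q (by rw [hp.2, hq.2]) (by rw [hp.2]; exact ha.1)
    have e4 : (S y).card = (((lowN G s y).erase x).filter (fun w => φ y w ≠ a)).card := rfl
    omega
  have hsum := Finset.sum_le_sum hSy
  rw [Finset.sum_add_distrib, Finset.sum_const, smul_eq_mul] at hsum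
  refine ⟨R, ?_, by omega, by omega, by omega⟩
  intro y hy
  rw [SimpleGraph.mem_neighborFinset]
  exact (hR y hy).1

lemma average {x y0 : V} {φ : V → V → ℕ} (_h : Col G D x y0 φ) {E : ℕ} (hE : 0 < E)
    (hDE : 8 * E ≤ D) (W : Finset (V × V)) (hW : ∀ p ∈ W, D ≤ E * (misF D φ p.2).card)
    (F : Finset ℕ) (hF : F.card ≤ 3) :
    ∃ k, k ≠ 0 ∧ k ≤ D ∧ k ∉ F ∧ ∃ W' ⊆ W, (∀ p ∈ W', Mis D φ p.2 k) ∧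
      W.card ≤ 2 * E * W'.card := by
  classical
  set I := (Finset.Icc 1 D) \ F with hI
  have hIc : 0 < I.card := by
    have := Finset.le_card_sdiff F (Finset.Icc 1 D)
    rw [Nat.card_Icc, Nat.add_sub_cancel, ← hI] at this
    omega
  have hID : I.card ≤ D := by
    have := Finset.card_le_card (Finset.sdiff_subset (s := Finset.Icc 1 D) (t := F))
    rw [Nat.card_Icc, Nat.add_sub_cancel, ← hI] at this
    exact this
  by_contra hcon
  push Not at hcon
  have h1 : ∀ k ∈ I, 2 * E * (W.filter (fun p => k ∈ misF D φ p.2)).card + 1 ≤ W.card := by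
    intro k hk
    rw [hI, Finset.mem_sdiff, Finset.mem_Icc] at hk
    have := hcon k (by omega) hk.1.2 hk.2 (W.filter (fun p => k ∈ misF D φ p.2))
      (Finset.filter_subset _ _) (fun p hp => mem_misF.1 (Finset.mem_filter.1 hp).2)
    omega
  have h2 := Finset.sum_le_sum h1
  rw [Finset.sum_add_distrib, ← Finset.mul_sum, Finset.sum_const, Finset.sum_const, smul_eq_mul,
    smul_eq_mul, mul_one] at h2
  have h3 : ∑ k ∈ I, (W.filter (fun p => k ∈ misF D φ p.2)).card =
      ∑ p ∈ W, (I.filter (fun k => k ∈ misF D φ p.2)).card := by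
    simp only [Finset.card_filter]
    rw [Finset.sum_comm]
  have h4 : ∀ p ∈ W, D ≤ 2 * E * (I.filter (fun k => k ∈ misF D φ p.2)).card := by
    intro p hp
    have e1 : misF D φ p.2 \ F ⊆ I.filter (fun k => k ∈ misF D φ p.2) := by
      intro k hk
      rw [Finset.mem_sdiff] at hk
      have hm := mem_misF.1 hk.1
      rw [Finset.mem_filter, hI, Finset.mem_sdiff, Finset.mem_Icc]
      exact ⟨⟨⟨Nat.one_le_iff_ne_zero.2 hm.1, hm.2.1⟩, hk.2⟩, hk.1⟩
    have e2 := Finset.card_le_card e1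
    have e3 := Finset.le_card_sdiff F (misF D φ p.2)
    have e4 := hW p hp
    have e5 : (misF D φ p.2).card ≤ (I.filter (fun k => k ∈ misF D φ p.2)).card + 3 := by omega
    nlinarith
  have h5 := Finset.sum_le_sum h4
  rw [Finset.sum_const, smul_eq_mul, ← Finset.mul_sum, ← h3] at h5
  have h6 : I.card * W.card ≤ W.card * D := by
    rw [mul_comm]; exact Nat.mul_le_mul_left _ hID
  omega

lemma pairs_biUnion_card (R : Finset V) (S : V → Finset V) [DecidableEq V] :
    (R.biUnion (fun y => (S y).image (fun w => (y, w)))).card = ∑ y ∈ R, (S y).card := by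
  rw [Finset.card_biUnion]
  · refine Finset.sum_congr rfl (fun y _ => ?_)
    rw [Finset.card_image_of_injective]
    intro w w' he
    exact (Prod.ext_iff.1 he).2
  · intro y _ y' _ hne
    simp only [Function.onFun]
    rw [Finset.disjoint_left]
    intro p hp hp'
    rw [Finset.mem_image] at hp hp'
    obtain ⟨w, _, rfl⟩ := hp
    obtain ⟨w', _, he⟩ := hp'
    exact hne (Prod.ext_iff.1 he).1.symm

lemma arith_mid {q H E b0 z0 r R2 m w w2 : ℕ} (hE : 0 < E) (hH : 0 < H)
    (hq : 3584 * E ^ 4 * H ^ 3 < q) (h1 : q + 1 ≤ H * b0) (h2 : z0 + 1 = b0)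
    (h3 : z0 ≤ 2 * E * (r + 1)) (hm : m = r / (2 * H)) (hR2 : 1 ≤ m → r ≤ 2 * R2)
    (hR2' : R2 ≤ r) (hr : r ≤ q) (hw : w = R2 * m) (hw2 : w ≤ 4 * E ^ 2 * w2)
    (hw3 : 1 ≤ m → w2 ≤ q + 4 * R2 + 2 * m) : False := by
  have hE1 : 1 ≤ E := hE
  have hH1 : 1 ≤ H := hH
  have hE4 : E ≤ E ^ 4 := Nat.le_self_pow (by norm_num) E
  have hH3 : H ≤ H ^ 3 := Nat.le_self_pow (by norm_num) H
  have hH2 : H ^ 2 ≤ H ^ 3 := Nat.pow_le_pow_right hH (by norm_num)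
  have a1 : E * H ≤ E ^ 4 * H ^ 3 := Nat.mul_le_mul hE4 hH3
  have a2 : E * H ^ 2 ≤ E ^ 4 * H ^ 3 := Nat.mul_le_mul hE4 hH2
  have a3 : H ≤ E * H := Nat.le_mul_of_pos_left H hE
  have b1 : H * b0 ≤ H * (2 * E * (r + 1)) + H := by
    have : b0 ≤ 2 * E * (r + 1) + 1 := by omega
    calc H * b0 ≤ H * (2 * E * (r + 1) + 1) := Nat.mul_le_mul_left _ this
      _ = _ := by ring
  have b2 : q ≤ 4 * (E * H) * r := by
    have : H * (2 * E * (r + 1)) = 2 * (E * H * r) + 2 * (E * H) := by ring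
    have e : 4 * (E * H) * r = 4 * (E * H * r) := by ring
    rw [e]
    have : 3584 * E ^ 4 * H ^ 3 = 3584 * (E ^ 4 * H ^ 3) := by ring
    omega
  have b3 : 4 * H ≤ r := by
    by_contra hc
    have : r ≤ 4 * H := by omega
    have : 4 * (E * H) * r ≤ 4 * (E * H) * (4 * H) := Nat.mul_le_mul_left _ this
    have e : 4 * (E * H) * (4 * H) = 16 * (E * H ^ 2) := by ring
    have e' : 3584 * E ^ 4 * H ^ 3 = 3584 * (E ^ 4 * H ^ 3) := by ring
    have : 0 < E ^ 4 * H ^ 3 := by positivity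
    omega
  have b4 : r < 2 * H * (m + 1) := by
    rw [hm]
    exact Nat.lt_mul_div_succ r (by positivity)
  have b5 : r ≤ 4 * H * m := by nlinarith
  have hm1 : 1 ≤ m := by
    by_contra hc
    have : m = 0 := by omega
    subst this
    omega
  have b6 := hR2 hm1
  have b7 := hw3 hm1
  have b8 : m ≤ r := by rw [hm]; exact Nat.div_le_self _ _
  have b9 : w2 ≤ 7 * q := by omega
  have c1 : r * r ≤ 8 * H * w := by
    calc r * r ≤ (2 * R2) * (4 * H * m) := Nat.mul_le_mul b6 b5
      _ = 8 * H * w := by rw [hw]; ring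
  have c2 : 8 * H * w ≤ 224 * H * E ^ 2 * q := by
    calc 8 * H * w ≤ 8 * H * (4 * E ^ 2 * (7 * q)) :=
          Nat.mul_le_mul_left _ (hw2.trans (Nat.mul_le_mul_left _ b9))
      _ = _ := by ring
  have c3 : q * q ≤ 3584 * E ^ 4 * H ^ 3 * q := by
    calc q * q ≤ (4 * (E * H) * r) * (4 * (E * H) * r) := Nat.mul_le_mul b2 b2
      _ = 16 * (E * H) ^ 2 * (r * r) := by ring
      _ ≤ 16 * (E * H) ^ 2 * (224 * H * E ^ 2 * q) := Nat.mul_le_mul_left _ (c1.trans c2)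
      _ = _ := by ring
  have hq0 : 0 < q := by omega
  have := Nat.le_of_mul_le_mul_right c3 hq0
  omega

lemma mis_congr {φ ψ : V → V → ℕ} {c : ℕ} (hc : ∀ u v, ψ u v = c ↔ φ u v = c) (u : V) :
    Mis D ψ u c ↔ Mis D φ u c := by
  unfold Mis
  simp only [ne_eq, hc]

lemma card_cover6 {β : Type*} [DecidableEq β] {W Q A1 A2 A3 A4 A5 A6 : Finset β}
    (h : W ⊆ Q ∪ (A1 ∪ (A2 ∪ (A3 ∪ (A4 ∪ (A5 ∪ A6)))))) :
    W.card ≤ Q.card + (A1.card + (A2.card + (A3.card + (A4.card + (A5.card + A6.card))))) := by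
  refine (Finset.card_le_card h).trans ?_
  refine (Finset.card_union_le _ _).trans (Nat.add_le_add_left ?_ _)
  refine (Finset.card_union_le _ _).trans (Nat.add_le_add_left ?_ _)
  refine (Finset.card_union_le _ _).trans (Nat.add_le_add_left ?_ _)
  refine (Finset.card_union_le _ _).trans (Nat.add_le_add_left ?_ _)
  refine (Finset.card_union_le _ _).trans (Nat.add_le_add_left ?_ _)
  exact Finset.card_union_le _ _

set_option maxHeartbeats 2000000 in
lemma mid_rows (hnc : NC G D) (hcol : ∀ x y, G.Adj x y → ∃ φ, Col G D x y φ)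
    (hD : ∀ v, G.degree v ≤ D) {E H : ℕ} (hE : 0 < E) (hH : 0 < H) (hDE : 8 * E ≤ D) {x : V}
    (hq : 3584 * E ^ 4 * H ^ 3 < G.degree x) (hx : G.degree x < D - D / E) :
    (H : ℝ) ≤ ∑ y ∈ G.neighborFinset x, 1 / ((lowN G (D - D / E) y).card : ℝ) := by
  classical
  set T := D - D / E with hT
  by_contra hcon
  push Not at hcon
  have hDE8 : 8 ≤ D / E := (Nat.le_div_iff_mul_le hE).2 hDE
  have hxl : ∀ y, G.Adj x y → x ∈ lowN G T y := fun y hy => mem_lowN.2 ⟨hy.symm, hx⟩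
  have hbpos : ∀ y, G.Adj x y → 0 < (lowN G T y).card := fun y hy =>
    Finset.card_pos.2 ⟨x, hxl y hy⟩
  have hbound : ∀ (R : Finset V) (B : ℕ), R ⊆ G.neighborFinset x →
      (∀ y ∈ R, (lowN G T y).card ≤ B) → H * B ≤ R.card → 0 < B → False := by
    intro R B hR hB hRB hB0
    have h1 : ∑ y ∈ R, 1 / ((lowN G T y).card : ℝ) ≤
        ∑ y ∈ G.neighborFinset x, 1 / ((lowN G T y).card : ℝ) :=
      Finset.sum_le_sum_of_subset_of_nonneg hR (fun _ _ _ => by positivity)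
    have h2 : ∑ y ∈ R, 1 / (B : ℝ) ≤ ∑ y ∈ R, 1 / ((lowN G T y).card : ℝ) := by
      refine Finset.sum_le_sum (fun y hy => ?_)
      have := hbpos y ((SimpleGraph.mem_neighborFinset G x y).1 (hR hy))
      exact one_div_le_one_div_of_le (by exact_mod_cast this) (by exact_mod_cast hB y hy)
    rw [Finset.sum_const, nsmul_eq_mul, mul_one_div] at h2
    have h3 : (H : ℝ) ≤ (R.card : ℝ) / B := by
      rw [le_div_iff₀ (by exact_mod_cast hB0)]
      exact_mod_cast hRB
    linarith
  have hmiss : ∀ (φ : V → V → ℕ) (y : V), Col G D x y φ → ∀ w, G.degree w < T →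
      D ≤ E * (misF D φ w).card := by
    intro φ y h w hw
    have h1 := prF_card h w
    have h2 := misF_add_prF (D := D) φ w
    have h3 : D / E + 1 ≤ (misF D φ w).card := by omega
    have h4 := Nat.lt_mul_div_succ D hE
    have h5 : E * (D / E + 1) ≤ E * (misF D φ w).card := Nat.mul_le_mul_left E h3
    omega
  -- the first row
  have hy0 : ∃ y0, G.Adj x y0 ∧ G.degree x + 1 ≤ H * (lowN G T y0).card := by
    by_contra hc
    push Not at hc
    refine hbound (G.neighborFinset x) (G.degree x / H) subset_rfl ?_ ?_ ?_
    · intro y hy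
      rw [Nat.le_div_iff_mul_le hH]
      have := hc y ((SimpleGraph.mem_neighborFinset G x y).1 hy)
      rw [mul_comm]; omega
    · rw [SimpleGraph.card_neighborFinset_eq_degree]
      exact Nat.mul_div_le _ _
    · refine Nat.div_pos ?_ hH
      have : H ≤ H ^ 3 := Nat.le_self_pow (by norm_num) H
      have : 1 ≤ E ^ 4 := Nat.one_le_pow _ _ hE
      nlinarith
  obtain ⟨y0, hxy, hb0⟩ := hy0
  obtain ⟨φ, h⟩ := hcol x y0 hxy
  obtain ⟨a, ha⟩ := exists_mis_end hD hxy h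
  have hMx : ∀ ψ, Col G D x y0 ψ → ∀ F : Finset ℕ, F.card ≤ 3 → ∃ g, Mis D ψ x g ∧ g ∉ F := by
    intro ψ hψ F hF
    have h1 := prF_card_end hxy hψ
    have h2 := misF_add_prF (D := D) ψ x
    have h3 := Finset.le_card_sdiff F (misF D ψ x)
    have : 0 < (misF D ψ x \ F).card := by omega
    obtain ⟨g, hg⟩ := Finset.card_pos.1 this
    rw [Finset.mem_sdiff, mem_misF] at hg
    exact ⟨g, hg⟩
  set Z0 := (lowN G T y0).erase x with hZ0
  have hZ0c : Z0.card + 1 = (lowN G T y0).card := Finset.card_erase_add_one (hxl y0 hxy)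
  obtain ⟨k, hk0, hkD, hkF, Wz, hWz, hWzm, hWzc⟩ := average h hE hDE (Z0.image (fun z => (y0, z)))
    (by
      intro p hp
      rw [Finset.mem_image] at hp
      obtain ⟨z, hz, rfl⟩ := hp
      exact hmiss φ y0 h z (mem_lowN.1 (Finset.mem_erase.1 hz).2).2) {a} (by simp)
  rw [Finset.card_image_of_injective _ (fun z z' he => (Prod.ext_iff.1 he).2)] at hWzc
  rw [Finset.mem_singleton] at hkF
  obtain ⟨g0, hg0, -⟩ := hMx φ h ∅ (by simp)
  obtain ⟨φ1, w0, h1, ha1, hk1x, hc1, hw1⟩ := swap_in hnc hxy h ha hkF hk0 hkD hg0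
  set Z1 := Z0.filter (fun z => k ∈ misF D φ1 z) with hZ1def
  have hZ1c : Wz.card ≤ Z1.card + 1 := by
    have e1 : Wz ⊆ (insert w0 Z1).image (fun z => (y0, z)) := by
      intro p hp
      have hp1 := hWz hp
      rw [Finset.mem_image] at hp1 ⊢
      obtain ⟨z, hz, rfl⟩ := hp1
      refine ⟨z, ?_, rfl⟩
      rw [Finset.mem_insert]
      by_cases hzw : z = w0
      · exact Or.inl hzw
      · right
        rw [hZ1def, Finset.mem_filter, mem_misF]
        exact ⟨hz, hw1 z hzw (hWzm _ hp)⟩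
    exact (Finset.card_le_card e1).trans (Finset.card_image_le.trans (Finset.card_insert_le _ _))
  have hZ1k : ∀ z ∈ Z1, Mis D φ1 z k := fun z hz => mem_misF.1 (Finset.mem_filter.1 hz).2
  have hZ1 : ∀ z ∈ Z1, φ1 y0 z ≠ 0 ∧ ¬ Mis D φ1 x (φ1 y0 z) := by
    intro z hz
    have hz0 := Finset.mem_erase.1 (Finset.mem_filter.1 hz).1
    refine ⟨color_ne_zero h1 (mem_lowN.1 hz0.2).1 hz0.1 hxy.ne.symm, fun hm => ?_⟩
    exact fan3 hnc hxy h1 ha1 rfl hm hk1x (hZ1k z hz)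
  obtain ⟨R, hRc, hR⟩ := mates h1 Z1 hZ1
  have hRN : R ⊆ G.neighborFinset x := by
    intro y hy
    rw [SimpleGraph.mem_neighborFinset]
    exact (hR y hy).1
  have hRq : R.card ≤ G.degree x := by
    rw [← SimpleGraph.card_neighborFinset_eq_degree]
    exact Finset.card_le_card hRN
  set m := R.card / (2 * H) with hm
  set R2 := R.filter (fun y => m + 1 ≤ (lowN G T y).card) with hR2
  have hR2c : 1 ≤ m → R.card ≤ 2 * R2.card := by
    intro hm1
    by_contra hc
    have e := Finset.card_filter_add_card_filter_not (s := R)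
      (fun y => m + 1 ≤ (lowN G T y).card)
    rw [← hR2] at e
    refine hbound (R.filter (fun y => ¬ (m + 1 ≤ (lowN G T y).card))) m
      ((Finset.filter_subset _ _).trans hRN) ?_ ?_ (by omega)
    · intro y hy
      have := (Finset.mem_filter.1 hy).2
      omega
    · have e2 : 2 * H * m ≤ R.card := Nat.mul_div_le _ _
      have e3 : 2 * H * m = 2 * (H * m) := by ring
      omega
  have hL : ∀ y, ∃ L ⊆ (lowN G T y).erase x, L.card ≤ m ∧ (y ∈ R2 → L.card = m) := by
    intro y
    by_cases hy : y ∈ R2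
    · have e1 := (Finset.mem_filter.1 hy).2
      have e2 := Finset.card_erase_add_one (hxl y (hR y (Finset.mem_filter.1 hy).1).1)
      obtain ⟨L, hL1, hL2⟩ := Finset.exists_subset_card_eq (s := (lowN G T y).erase x) (n := m)
        (by omega)
      exact ⟨L, hL1, hL2.le, fun _ => hL2⟩
    · exact ⟨∅, by simp, by simp, fun q => absurd q hy⟩
  choose L hLs hLm hLc using hL
  set W := R2.biUnion (fun y => (L y).image (fun w => (y, w))) with hW
  have hWc : W.card = R2.card * m := by
    rw [hW, pairs_biUnion_card, Finset.sum_congr rfl (fun y hy => hLc y hy), Finset.sum_const,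
      smul_eq_mul]
  have hWm : ∀ p ∈ W, p.1 ∈ R2 ∧ p.2 ∈ L p.1 := by
    intro p hp
    rw [hW, Finset.mem_biUnion] at hp
    obtain ⟨y, hy, hp⟩ := hp
    rw [Finset.mem_image] at hp
    obtain ⟨w, hw, rfl⟩ := hp
    exact ⟨hy, hw⟩
  have hWl : ∀ p ∈ W, p.2 ≠ x ∧ G.Adj p.1 p.2 ∧ G.degree p.2 < T := by
    intro p hp
    have := hLs p.1 (hWm p hp).2
    rw [Finset.mem_erase, mem_lowN] at this
    exact this
  obtain ⟨k1, hk10, hk1D, hk1F, W1, hW1, hW1m, hW1c⟩ := average h1 hE hDE W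
    (fun p hp => hmiss φ1 y0 h1 p.2 (hWl p hp).2.2) {a, k} (Finset.card_le_two.trans (by norm_num))
  obtain ⟨k2, hk20, hk2D, hk2F, W2, hW2, hW2m, hW2c⟩ := average h1 hE hDE W1
    (fun p hp => hmiss φ1 y0 h1 p.2 (hWl p (hW1 hp)).2.2) {a, k, k1} Finset.card_le_three
  simp only [Finset.mem_insert, Finset.mem_singleton, not_or] at hk1F hk2F
  obtain ⟨g1, hg1, hg1F⟩ := hMx φ1 h1 {k, k1, k2} Finset.card_le_three
  simp only [Finset.mem_insert, Finset.mem_singleton, not_or] at hg1F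
  obtain ⟨φ2, v1, h2, ha2, hk1x2, hc2, hv1⟩ := swap_in hnc hxy h1 ha1 hk1F.1 hk10 hk1D hg1
  obtain ⟨g2, hg2, hg2F⟩ := hMx φ2 h2 {k, k1, k2} Finset.card_le_three
  simp only [Finset.mem_insert, Finset.mem_singleton, not_or] at hg2F
  obtain ⟨φ3, v2, h3, ha3, hk2x3, hc3, hv2⟩ := swap_in hnc hxy h2 ha2 hk2F.1 hk20 hk2D hg2
  have tk : ∀ u, Mis D φ3 u k ↔ Mis D φ1 u k := fun u =>
    (mis_congr (hc3 k (Ne.symm hk2F.2.1) (Ne.symm hg2F.1)) u).trans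
      (mis_congr (hc2 k (Ne.symm hk1F.2) (Ne.symm hg1F.1)) u)
  have tk1 : ∀ u, Mis D φ3 u k1 ↔ Mis D φ2 u k1 := fun u =>
    mis_congr (hc3 k1 (Ne.symm hk2F.2.2) (Ne.symm hg2F.2.1)) u
  have tk2 : ∀ u, Mis D φ2 u k2 ↔ Mis D φ1 u k2 := fun u =>
    mis_congr (hc2 k2 hk2F.2.2 (Ne.symm hg1F.2.2)) u
  set Q := W2.filter (fun p => φ1 x p.1 ≠ k1 ∧ φ1 x p.1 ≠ k2 ∧ p.2 ≠ v1 ∧ p.2 ≠ v2 ∧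
    φ3 p.1 p.2 ≠ a ∧ φ3 p.1 p.2 ≠ k) with hQ
  have hQc := pairs_card hnc hxy h3 ha3 ((tk1 x).2 hk1x2) Q (by
    intro p hp
    rw [hQ, Finset.mem_filter] at hp
    obtain ⟨hpW2, p1, p2, p3, p4, p5, p6⟩ := hp
    have hpW := hW1 (hW2 hpW2)
    obtain ⟨hpx, hpadj, hpdeg⟩ := hWl p hpW
    have hpR := (Finset.mem_filter.1 (hWm p hpW).1).1
    obtain ⟨hxy', _, z, hz, hzy⟩ := hR p.1 hpR
    have hj0 : φ1 x p.1 ≠ 0 := by rw [← hzy]; exact (hZ1 z hz).1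
    have e1 : φ2 x p.1 = φ1 x p.1 := (hc2 _ p1 (hg1.2.2 p.1) _ _).2 rfl
    have e2 : φ2 y0 z = φ1 x p.1 := (hc2 _ p1 (hg1.2.2 p.1) _ _).2 hzy
    have hg2' : φ1 x p.1 ≠ g2 := by rw [← e1]; exact hg2.2.2 p.1
    have e3 : φ3 x p.1 = φ1 x p.1 := (hc3 _ p2 hg2' _ _).2 e1
    have e4 : φ3 y0 z = φ1 x p.1 := (hc3 _ p2 hg2' _ _).2 e2
    have hl0 := color_ne_zero h3 hpadj hpx hxy'.ne.symm
    have hlj : φ3 p.1 p.2 ≠ φ1 x p.1 := by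
      rw [← e3, h3.symm x p.1]
      intro q
      exact hpx (h3.inj p.1 p.2 x q hl0)
    have m1 : Mis D φ3 p.2 k1 := (tk1 _).2 (hv1 _ p3 (hW1m p (hW2 hpW2)))
    have m2 : Mis D φ3 p.2 k2 := hv2 _ p4 ((tk2 _).2 (hW2m p hpW2))
    have key := row_chain hnc hxy h3 ha3 e4 hj0 ((tk x).2 hk1x) ((tk z).2 (hZ1k z hz)) e3 rfl hl0
      p5 p6 hlj ((tk1 x).2 hk1x2) hk2x3 m1 m2 hk1F.2 hk2F.2.1 (Ne.symm hk2F.2.2)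
    exact ⟨hl0, p5, hpx, m1, key.1, key.2⟩)
  have x1 : ∀ c, c ≠ 0 → (W.filter (fun p => φ1 x p.1 = c)).card ≤ m := by
    intro c hc
    by_cases hne : ∃ y, φ1 x y = c
    · obtain ⟨y, hy⟩ := hne
      have : W.filter (fun p => φ1 x p.1 = c) ⊆ (L y).image (fun w => (y, w)) := by
        intro p hp
        rw [Finset.mem_filter] at hp
        have e : p.1 = y := h1.inj x p.1 y (by rw [hp.2, hy]) (by rw [hp.2]; exact hc)
        rw [Finset.mem_image]
        refine ⟨p.2, ?_, Prod.ext e.symm rfl⟩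
        rw [← e]; exact (hWm p hp.1).2
      exact (Finset.card_le_card this).trans (Finset.card_image_le.trans (hLm y))
    · push Not at hne
      rw [Finset.filter_false_of_mem (fun p _ => hne p.1)]
      simp
  have x2 : ∀ v, (W.filter (fun p => p.2 = v)).card ≤ R2.card := by
    intro v
    refine Finset.card_le_card_of_injOn (fun p => p.1) ?_ ?_
    · intro p hp
      exact (hWm p (Finset.mem_filter.1 hp).1).1
    · intro p hp p' hp' he
      have := (Finset.mem_filter.1 hp).2
      have h' := (Finset.mem_filter.1 hp').2
      exact Prod.ext he (by rw [this, h'])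
  have x3 : ∀ c, c ≠ 0 → (W.filter (fun p => φ3 p.1 p.2 = c)).card ≤ R2.card := by
    intro c hc
    refine Finset.card_le_card_of_injOn (fun p => p.1) ?_ ?_
    · intro p hp
      exact (hWm p (Finset.mem_filter.1 hp).1).1
    · intro p hp p' hp' he
      have e1 := (Finset.mem_filter.1 hp).2
      have e2 := (Finset.mem_filter.1 hp').2
      simp only at he
      rw [← he] at e2
      exact Prod.ext he (h3.inj p.1 p.2 p'.2 (by rw [e1, e2]) (by rw [e1]; exact hc))
  have hcover : W2 ⊆ Q ∪ (W.filter (fun p => φ1 x p.1 = k1) ∪ (W.filter (fun p => φ1 x p.1 = k2) ∪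
      (W.filter (fun p => p.2 = v1) ∪ (W.filter (fun p => p.2 = v2) ∪
      (W.filter (fun p => φ3 p.1 p.2 = a) ∪ W.filter (fun p => φ3 p.1 p.2 = k)))))) := by
    intro p hp
    have hpW := hW1 (hW2 hp)
    simp only [Finset.mem_union, hQ, Finset.mem_filter]
    tauto
  have hW2le : W2.card ≤ G.degree x + 4 * R2.card + 2 * m := by
    have f := card_cover6 hcover
    have g1 := x1 k1 hk10
    have g2 := x1 k2 hk20
    have g3 := x2 v1
    have g4 := x2 v2
    have g5 := x3 a ha.1
    have g6 := x3 k hk0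
    linarith
  refine arith_mid (w := W.card) (w2 := W2.card) hE hH hq hb0 hZ0c (r := R.card) (R2 := R2.card)
    (m := m) ?_ hm hR2c (Finset.card_filter_le _ _) hRq hWc ?_ (fun _ => hW2le)
  · rw [hRc]
    exact hWzc.trans (Nat.mul_le_mul_left _ hZ1c)
  · calc W.card ≤ 2 * E * W1.card := hW1c
      _ ≤ 2 * E * (2 * E * W2.card) := Nat.mul_le_mul_left _ hW2c
      _ = _ := by ring

end counting

section final
set_option linter.unusedSectionVars false
variable {G : SimpleGraph V} {D : ℕ}

lemma nc_of_chrom (h : chromIndex G = D + 1) : NC G D := by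
  classical
  intro x y φ hxy hφ a hx hy
  have hmem : D ∈ {k | ∃ φ : V → V → ℕ, IsEdgeColoring G k φ} := by
    refine ⟨fun u v => if (u = x ∧ v = y) ∨ (u = y ∧ v = x) then a else φ u v, ?_, ?_, ?_⟩
    · intro u v
      have e : ((u = x ∧ v = y) ∨ (u = y ∧ v = x)) ↔ ((v = x ∧ u = y) ∨ (v = y ∧ u = x)) := by
        tauto
      simp only [e, hφ.symm u v]
    · intro u v huv
      rw [Finset.mem_Icc]
      dsimp only
      split_ifs with hc
      · exact ⟨Nat.one_le_iff_ne_zero.2 hx.1, hx.2.1⟩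
      · push Not at hc
        refine ⟨Nat.one_le_iff_ne_zero.2 ((hφ.supp u v).2 ⟨huv, ?_, ?_⟩), hφ.le u v⟩
        · tauto
        · tauto
    · intro v p q hp hq hpq
      dsimp only
      have hne := hxy.ne
      split_ifs with h1 h2 h2
      · exfalso
        rcases h1 with ⟨r1, r2⟩ | ⟨r1, r2⟩ <;> rcases h2 with ⟨r3, r4⟩ | ⟨r3, r4⟩
        · exact hpq (r2.trans r4.symm)
        · exact hne (r1.symm.trans r3)
        · exact hne (r3.symm.trans r1)
        · exact hpq (r2.trans r4.symm)
      · rcases h1 with ⟨r1, r2⟩ | ⟨r1, r2⟩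
        · rw [r1]; exact (hx.2.2 q).symm
        · rw [r1]; exact (hy.2.2 q).symm
      · rcases h2 with ⟨r1, r2⟩ | ⟨r1, r2⟩
        · rw [r1]; exact (hx.2.2 p)
        · rw [r1]; exact (hy.2.2 p)
      · intro he
        refine hpq (hφ.inj v p q he ((hφ.supp v p).2 ⟨hp, ?_, ?_⟩))
        · tauto
        · tauto
  have := Nat.sInf_le hmem
  unfold chromIndex at h
  omega

lemma col_of_chrom {x y : V} (_hxy : G.Adj x y) (hD : 0 < D)
    (h : chromIndex (G.deleteEdges {s(x, y)}) = D) : ∃ φ, Col G D x y φ := by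
  classical
  have hne : {k | ∃ φ : V → V → ℕ, IsEdgeColoring (G.deleteEdges {s(x, y)}) k φ}.Nonempty := by
    by_contra hc
    rw [Set.not_nonempty_iff_eq_empty] at hc
    unfold chromIndex at h
    rw [hc, Nat.sInf_empty] at h
    omega
  have hmem := Nat.sInf_mem hne
  unfold chromIndex at h
  rw [h] at hmem
  obtain ⟨φ, h1, h2, h3⟩ := hmem
  have hadj : ∀ u v, (G.deleteEdges {s(x, y)}).Adj u v ↔
      (G.Adj u v ∧ ¬(u = x ∧ v = y) ∧ ¬(u = y ∧ v = x)) := by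
    intro u v
    rw [SimpleGraph.deleteEdges_adj, Set.mem_singleton_iff, Sym2.eq_iff]
    tauto
  set K := G.deleteEdges {s(x, y)} with hK
  refine ⟨fun u v => if K.Adj u v then φ u v else 0, ?_, ?_, ?_, ?_⟩
  · intro u v
    simp only [K.adj_comm u v, h1 u v]
  · intro u v
    split_ifs with hc
    · exact (Finset.mem_Icc.1 (h2 hc)).2
    · omega
  · intro v p q he h0
    split_ifs at he h0 with c1 c2
    · by_contra hpq
      exact h3 c1 c2 hpq he
    · exact absurd he h0
    · exact absurd rfl h0
    · exact absurd rfl h0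
  · intro u v
    rw [← hadj]
    split_ifs with hc
    · have := (Finset.mem_Icc.1 (h2 hc)).1
      exact ⟨fun _ => hc, fun _ => by omega⟩
    · exact ⟨fun q => absurd rfl q, fun q => absurd q hc⟩

lemma inv_lin {b : ℝ} (hb : 0 < b) (t : ℝ) : 2 * t - t ^ 2 * b ≤ 1 / b := by
  rw [le_div_iff₀ hb]
  nlinarith [sq_nonneg (t * b - 1)]

lemma num_low {m b : ℝ} (hm : 2.66 ≤ m) (hb : 0 < b) :
    1.2 * m ≤ 2 * (0.7 / m) * (b - 1) - (0.7 / m) ^ 2 * (m ^ 3 + b - 3) +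
      ((m ^ 3 + 1) / b - 1) := by
  have hm0 : 0 < m := by linarith
  set v := 1.18 * m - 0.2 with hv
  have hk : 0 < m ^ 3 + 1 := by positivity
  set r := 0.7 / m with hr
  have hrm : r * m = 0.7 := by rw [hr]; field_simp
  have hr0 : 0 < r := by positivity
  have h2 : v ^ 2 ≤ (2 * r - r ^ 2) * (m ^ 3 + 1) := by
    have e : (2 * r - r ^ 2) * (m ^ 3 + 1) = 1.4 * m ^ 2 - 0.49 * m + (1.4 * m - 0.49) / m ^ 2 := by
      rw [hr]; field_simp; ring
    rw [e, hv]
    have : 0.04 - 0.0076 * m ^ 2 + 0.018 * m ≤ (1.4 * m - 0.49) / m ^ 2 := by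
      rw [le_div_iff₀ (by positivity)]
      have a1 : 0 ≤ (0.0076 * m - 0.018 - 0.0022) * m ^ 3 :=
        mul_nonneg (by linarith) (by positivity)
      nlinarith [mul_nonneg hm0.le (sq_nonneg (m - 9.09))]
    nlinarith
  have h1 : 2 * v - (2 * r - r ^ 2) * b ≤ (m ^ 3 + 1) / b := by
    have := inv_lin hb (v / (m ^ 3 + 1))
    have e : (m ^ 3 + 1) / b = (m ^ 3 + 1) * (1 / b) := by ring
    rw [e]
    have h3 := mul_le_mul_of_nonneg_left this hk.le
    have e2 : (m ^ 3 + 1) * (2 * (v / (m ^ 3 + 1)) - (v / (m ^ 3 + 1)) ^ 2 * b) =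
      2 * v - v ^ 2 / (m ^ 3 + 1) * b := by field_simp
    rw [e2] at h3
    have h4 : v ^ 2 / (m ^ 3 + 1) ≤ 2 * r - r ^ 2 := by
      rw [div_le_iff₀ hk]; exact h2
    nlinarith
  have h5 : r ^ 2 * (m ^ 3 - 3) = 0.49 * m - 3 * r ^ 2 := by
    have : r ^ 2 * m ^ 3 = (r * m) ^ 2 * m := by ring
    rw [mul_sub, this, hrm]; ring
  have h6 : 1.2 * m ≤ 2 * v - 2 * r - (0.49 * m - 3 * r ^ 2) - 1 := by
    rw [hv]
    have hr1 : r ≤ 0.2632 := by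
      rw [hr, div_le_iff₀ hm0]; linarith
    nlinarith
  nlinarith

lemma cube_root_facts {x : ℝ} (hx : 0 ≤ x) : (x ^ ((1 : ℝ) / 3)) ^ 3 = x := by
  rw [← Real.rpow_natCast, ← Real.rpow_mul hx]; norm_num

lemma nat_consts {N D p : ℕ} (hN : 21 ≤ N) (hp : 105 ≤ p) (hD : N ^ p ≤ D) :
    (N ^ 17) ^ 3 + 2 * N ^ 17 + 4 ≤ D ∧ 8 * N ^ 2 ≤ D ∧
      3584 * (N ^ 2) ^ 4 * (N ^ 2) ^ 3 < N ^ 17 := by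
  have h0 : ∀ j, j ≤ 105 → N ^ j ≤ D := fun j hj =>
    (Nat.pow_le_pow_right (by omega) (hj.trans hp)).trans hD
  have h52 := h0 52 (by norm_num)
  have h3 := h0 3 (by norm_num)
  have e1 : N ^ 17 ≤ N ^ 51 := Nat.pow_le_pow_right (by omega) (by norm_num)
  have e2 : 1 ≤ N ^ 51 := Nat.one_le_pow _ _ (by omega)
  have e3 : N ^ 52 = N ^ 51 * N := by rw [pow_succ]
  have e4 : N ^ 51 * 21 ≤ N ^ 51 * N := Nat.mul_le_mul_left _ hN
  have e5 : (N ^ 17) ^ 3 = N ^ 51 := by rw [← pow_mul]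
  refine ⟨by rw [e5]; omega, ?_, ?_⟩
  · have : N ^ 3 = N ^ 2 * N := by ring
    have : N ^ 2 * 21 ≤ N ^ 2 * N := Nat.mul_le_mul_left _ hN
    omega
  · have e6 : 3584 * (N ^ 2) ^ 4 * (N ^ 2) ^ 3 = N ^ 14 * 3584 := by ring
    have e7 : N ^ 17 = N ^ 14 * N ^ 3 := by ring
    have e8 : 21 ^ 3 ≤ N ^ 3 := Nat.pow_le_pow_left hN 3
    rw [e6, e7]
    exact Nat.mul_lt_mul_of_pos_left (by omega) (by positivity)

lemma num_beta {d : ℝ} (hd : 19 ≤ d) {c t : ℝ} (hc0 : 0 ≤ c) (ht0 : 0 ≤ t)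
    (hc : c ^ 3 = (d - 1) * d) (ht : t ^ 3 = d) :
    1 ≤ (c / (d + 2) - 3 / (d + 2) ^ 2) * (1.2 * t) ∧ 0 ≤ c / (d + 2) - 3 / (d + 2) ^ 2 := by
  have hN : 0 < d + 2 := by linarith
  have h1 : d - 1 ≤ c * t := by
    refine le_of_pow_le_pow_left₀ (n := 3) (by norm_num) (by positivity) ?_
    rw [mul_pow, hc, ht]
    have : 0 ≤ (d - 1) := by linarith
    nlinarith
  have h2 : t ≤ (d + 2) / 7 := by
    refine le_of_pow_le_pow_left₀ (n := 3) (by norm_num) (by positivity) ?_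
    rw [ht, div_pow, le_div_iff₀ (by norm_num)]
    nlinarith [mul_nonneg hN.le (sq_nonneg (d - 19))]
  have h3 : 1 ≤ (c / (d + 2) - 3 / (d + 2) ^ 2) * (1.2 * t) := by
    have e : (c / (d + 2) - 3 / (d + 2) ^ 2) * (1.2 * t) =
        1.2 * (c * t * (d + 2) - 3 * t) / (d + 2) ^ 2 := by field_simp
    rw [e, le_div_iff₀ (by positivity)]
    have := mul_le_mul_of_nonneg_right h1 hN.le
    nlinarith
  refine ⟨h3, ?_⟩
  by_contra hcon
  push Not at hcon
  have := mul_nonpos_of_nonpos_of_nonneg hcon.le (by positivity : 0 ≤ 1.2 * t)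
  linarith

variable [Fintype V] [DecidableRel G.Adj]

lemma low_sum (hnc : NC G D) (hcol : ∀ x y, G.Adj x y → ∃ φ, Col G D x y φ)
    (hD : ∀ v, G.degree v ≤ D) {s : ℕ} (hs : s ^ 3 + 2 * s + 4 ≤ D) {x : V}
    (hx : G.degree x < s) (hx19 : 19 ≤ G.degree x) {m : ℝ} (hm0 : 0 ≤ m)
    (hm : m ^ 3 = G.degree x) :
    1.2 * m ≤ ∑ y ∈ G.neighborFinset x, 1 / ((lowN G s y).card : ℝ) := by
  classical
  have hne : (G.neighborFinset x).Nonempty := by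
    rw [← Finset.card_pos, SimpleGraph.card_neighborFinset_eq_degree]; omega
  obtain ⟨y0, hy0, hy0m⟩ := Finset.exists_max_image (G.neighborFinset x)
    (fun y => (lowN G s y).card) hne
  have hxy := (SimpleGraph.mem_neighborFinset G x y0).1 hy0
  obtain ⟨R, hR, hRc, hRs, hb1⟩ := low_rows hnc hcol hD hs hx hxy
    (fun y hy => hy0m y ((SimpleGraph.mem_neighborFinset G x y).2 hy))
  have hpos : ∀ y ∈ G.neighborFinset x, (0 : ℝ) < (lowN G s y).card := by
    intro y hy
    have hadj := (SimpleGraph.mem_neighborFinset G x y).1 hy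
    exact_mod_cast Finset.card_pos.2 ⟨x, mem_lowN.2 ⟨hadj.symm, hx⟩⟩
  have hb0 := hpos y0 hy0
  set b : ℝ := ((lowN G s y0).card : ℝ) with hb
  have hm266 : 2.66 ≤ m := by
    refine le_of_pow_le_pow_left₀ (n := 3) (by norm_num) hm0 ?_
    rw [hm]
    have : (19 : ℝ) ≤ G.degree x := by exact_mod_cast hx19
    exact le_trans (by norm_num) this
  have key := num_low hm266 hb0
  have hm' : 0 < m := by linarith
  set r := 0.7 / m with hr
  have hRcR : (R.card : ℝ) = b - 1 := by
    have : (R.card : ℝ) + 1 = b := by rw [hb]; exact_mod_cast hRc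
    linarith
  have hRsR : ∑ y ∈ R, ((lowN G s y).card : ℝ) ≤ m ^ 3 + b - 3 := by
    have : ∑ y ∈ R, ((lowN G s y).card : ℝ) + 3 ≤ G.degree x + b := by
      rw [hb]; exact_mod_cast hRs
    rw [hm]; linarith
  have p1 : 2 * r * (b - 1) - r ^ 2 * (m ^ 3 + b - 3) ≤ ∑ y ∈ R, 1 / ((lowN G s y).card : ℝ) := by
    have e : ∑ y ∈ R, (2 * r - r ^ 2 * ((lowN G s y).card : ℝ)) ≤
        ∑ y ∈ R, 1 / ((lowN G s y).card : ℝ) :=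
      Finset.sum_le_sum (fun y hy => inv_lin (hpos y (hR hy)) r)
    rw [Finset.sum_sub_distrib, Finset.sum_const, nsmul_eq_mul, hRcR, ← Finset.mul_sum] at e
    have := mul_le_mul_of_nonneg_left hRsR (sq_nonneg r)
    linarith
  have p2 : (m ^ 3 + 1) / b - 1 ≤ ∑ y ∈ G.neighborFinset x \ R, 1 / ((lowN G s y).card : ℝ) := by
    have e : ∑ y ∈ G.neighborFinset x \ R, 1 / b ≤
        ∑ y ∈ G.neighborFinset x \ R, 1 / ((lowN G s y).card : ℝ) := by
      refine Finset.sum_le_sum (fun y hy => ?_)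
      have hy' := (Finset.mem_sdiff.1 hy).1
      refine one_div_le_one_div_of_le (hpos y hy') ?_
      rw [hb]; exact_mod_cast hy0m y hy'
    have ec : ((G.neighborFinset x \ R).card : ℝ) = m ^ 3 - (b - 1) := by
      rw [Finset.cast_card_sdiff hR, SimpleGraph.card_neighborFinset_eq_degree, hRcR, hm]
    rw [Finset.sum_const, nsmul_eq_mul, ec] at e
    have : (m ^ 3 + 1) / b - 1 = (m ^ 3 - (b - 1)) * (1 / b) := by field_simp; ring
    linarith
  rw [← Finset.sum_sdiff hR]
  linarith

lemma lowN_sum_le (T : ℕ) (y : V) :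
    ∑ x ∈ G.neighborFinset y, (if G.degree x < T then 1 / ((lowN G T y).card : ℝ) else 0) ≤ 1 := by
  classical
  rw [← Finset.sum_filter, Finset.sum_const, nsmul_eq_mul, mul_one_div]
  have : (G.neighborFinset y).filter (fun x => G.degree x < T) = lowN G T y := by
    ext z
    rw [Finset.mem_filter, mem_lowN, SimpleGraph.mem_neighborFinset]
  rw [this]
  exact div_self_le_one _

lemma discharge [DecidableEq V] (hD : ∀ v, G.degree v ≤ D) (I : Finset V)
    (hI : ∀ u ∈ I, ∀ v ∈ I, u ≠ v → ¬ G.Adj u v) {κ η β : ℝ} (hκ : 0 ≤ κ) (hη : 0 ≤ η)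
    (hβ : 0 ≤ β) (T s : ℕ)
    (h : ∀ x ∈ I, (1 ≤ κ * G.degree x) ∨
      (G.degree x < T ∧ 1 ≤ η * ∑ y ∈ G.neighborFinset x, 1 / ((lowN G T y).card : ℝ)) ∨
      (G.degree x < s ∧ 1 ≤ β * ∑ y ∈ G.neighborFinset x, 1 / ((lowN G s y).card : ℝ))) :
    (I.card : ℝ) ≤ (Iᶜ.card : ℝ) * (κ * D + η + β) := by
  set w : V → V → ℝ := fun y x => κ + η * (if G.degree x < T then 1 / ((lowN G T y).card : ℝ) else 0)
    + β * (if G.degree x < s then 1 / ((lowN G s y).card : ℝ) else 0) with hw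
  have hif : ∀ (T : ℕ) (x y : V),
      0 ≤ (if G.degree x < T then 1 / ((lowN G T y).card : ℝ) else 0) := by
    intro T x y
    split_ifs <;> positivity
  have hw0 : ∀ y x, 0 ≤ w y x := by
    intro y x
    have := mul_nonneg hη (hif T x y)
    have := mul_nonneg hβ (hif s x y)
    simp only [hw]
    linarith
  have h1 : ∀ x ∈ I, 1 ≤ ∑ y ∈ G.neighborFinset x, w y x := by
    intro x hx
    simp only [hw]
    rw [Finset.sum_add_distrib, Finset.sum_add_distrib, Finset.sum_const, nsmul_eq_mul,
      SimpleGraph.card_neighborFinset_eq_degree, ← Finset.mul_sum, ← Finset.mul_sum]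
    have a1 : 0 ≤ (G.degree x : ℝ) * κ := by positivity
    have a2 := mul_nonneg hη (Finset.sum_nonneg (s := G.neighborFinset x) (fun y _ => hif T x y))
    have a3 := mul_nonneg hβ (Finset.sum_nonneg (s := G.neighborFinset x) (fun y _ => hif s x y))
    rcases h x hx with q | ⟨q1, q⟩ | ⟨q1, q⟩
    · linarith
    · simp only [if_pos q1] at a2 ⊢
      linarith
    · simp only [if_pos q1] at a3 ⊢
      linarith
  have h2 : (I.card : ℝ) ≤ ∑ x ∈ I, ∑ y ∈ G.neighborFinset x, w y x := by
    have := Finset.sum_le_sum h1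
    rwa [Finset.sum_const, nsmul_eq_mul, mul_one] at this
  have h3 : ∑ x ∈ I, ∑ y ∈ G.neighborFinset x, w y x =
      ∑ y ∈ Iᶜ, ∑ x ∈ I ∩ G.neighborFinset y, w y x := by
    refine Finset.sum_comm' ?_
    intro x y
    rw [Finset.mem_inter, Finset.mem_compl, SimpleGraph.mem_neighborFinset,
      SimpleGraph.mem_neighborFinset]
    constructor
    · rintro ⟨hx, hxy⟩
      exact ⟨⟨hx, hxy.symm⟩, fun hy => hI x hx y hy hxy.ne hxy⟩
    · rintro ⟨⟨hx, hxy⟩, _⟩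
      exact ⟨hx, hxy.symm⟩
  have h4 : ∀ y ∈ Iᶜ, ∑ x ∈ I ∩ G.neighborFinset y, w y x ≤ κ * D + η + β := by
    intro y _
    refine (Finset.sum_le_sum_of_subset_of_nonneg Finset.inter_subset_right
      (fun x _ _ => hw0 y x)).trans ?_
    simp only [hw]
    rw [Finset.sum_add_distrib, Finset.sum_add_distrib, Finset.sum_const, nsmul_eq_mul,
      SimpleGraph.card_neighborFinset_eq_degree, ← Finset.mul_sum, ← Finset.mul_sum]
    have b1 := mul_le_mul_of_nonneg_left (lowN_sum_le (G := G) T y) hη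
    have b2 := mul_le_mul_of_nonneg_left (lowN_sum_le (G := G) s y) hβ
    have b3 : (G.degree y : ℝ) ≤ D := by exact_mod_cast hD y
    have b4 := mul_le_mul_of_nonneg_left b3 hκ
    linarith
  have h5 := Finset.sum_le_sum h4
  rw [Finset.sum_const, nsmul_eq_mul] at h5
  linarith

lemma indepNum_attained (G : SimpleGraph V) : ∃ I : Finset V,
    (∀ u ∈ I, ∀ v ∈ I, u ≠ v → ¬ G.Adj u v) ∧ I.card = indepNum G := by
  have hne : {n | ∃ s : Finset V, (∀ u ∈ s, ∀ v ∈ s, u ≠ v → ¬ G.Adj u v) ∧ s.card = n}.Nonempty :=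
    ⟨0, ∅, by simp, rfl⟩
  have hbd : BddAbove
      {n | ∃ s : Finset V, (∀ u ∈ s, ∀ v ∈ s, u ≠ v → ¬ G.Adj u v) ∧ s.card = n} := by
    refine ⟨Fintype.card V, ?_⟩
    rintro n ⟨s, _, rfl⟩
    exact Finset.card_le_univ s
  exact Nat.sSup_mem hne hbd

end final

/-- Let `d ≥ 19` be an integer and let `G` be an `n`-vertex `Δ`-critical simple graph with
minimum degree at least `d` and maximum degree `Δ ≥ (d+2)^(5d+10)`. Then
`α(G) < ((d + 2 + ((d-1)d)^(1/3)) / (2d + 4 + ((d-1)d)^(1/3))) n`. -/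
theorem statement3 {V : Type*} [Fintype V] (G : SimpleGraph V) [DecidableRel G.Adj]
    (d : ℕ) (hd : 19 ≤ d)
    (hG : IsDeltaCritical G) (hmin : ∀ v : V, d ≤ G.degree v)
    (hmax : (d + 2) ^ (5 * d + 10) ≤ G.maxDegree) :
    (indepNum G : ℝ) <
      (((d : ℝ) + 2 + (((d : ℝ) - 1) * d) ^ ((1 : ℝ) / 3)) /
          (2 * d + 4 + (((d : ℝ) - 1) * d) ^ ((1 : ℝ) / 3))) * (Fintype.card V : ℝ) := by
  classical
  obtain ⟨hconn, hchi, hcrit⟩ := hG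
  set D := G.maxDegree with hDdef
  have hN21 : 21 ≤ d + 2 := by omega
  obtain ⟨hs, h8, h3584⟩ := nat_consts hN21 (by omega : 105 ≤ 5 * d + 10) hmax
  have hD : ∀ v, G.degree v ≤ D := fun v => G.degree_le_maxDegree v
  clear hmax
  obtain ⟨E, hE⟩ : ∃ E, E = (d + 2) ^ 2 := ⟨_, rfl⟩
  obtain ⟨S, hS⟩ : ∃ S, S = (d + 2) ^ 17 := ⟨_, rfl⟩
  have hE0 : 0 < E := by rw [hE]; positivity
  have hER : (E : ℝ) = ((d : ℝ) + 2) ^ 2 := by rw [hE]; push_cast; ring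
  rw [← hS] at hs h3584
  rw [← hE] at h8 h3584
  clear hS hE
  have hD0 : 0 < D := by omega
  have hnc : NC G D := nc_of_chrom hchi
  have hcol : ∀ x y, G.Adj x y → ∃ φ, Col G D x y φ := fun x y hxy =>
    col_of_chrom hxy hD0 (hcrit _ hxy)
  obtain ⟨I, hI, hIc⟩ := indepNum_attained G
  have hd' : (19 : ℝ) ≤ d := by exact_mod_cast hd
  set c := (((d : ℝ) - 1) * d) ^ ((1 : ℝ) / 3) with hc
  have hcn : (0 : ℝ) ≤ ((d : ℝ) - 1) * d := mul_nonneg (by linarith) (by linarith)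
  have hc0 : 0 ≤ c := Real.rpow_nonneg hcn _
  have hc3 : c ^ 3 = ((d : ℝ) - 1) * d := cube_root_facts hcn
  set t := (d : ℝ) ^ ((1 : ℝ) / 3) with ht
  have ht0 : 0 ≤ t := Real.rpow_nonneg (by linarith) _
  have ht3 : t ^ 3 = d := cube_root_facts (by linarith)
  obtain ⟨hβ1, hβ0⟩ := num_beta hd' hc0 ht0 hc3 ht3
  set β := c / ((d : ℝ) + 2) - 3 / ((d : ℝ) + 2) ^ 2 with hβ
  have hN : (0 : ℝ) < (d : ℝ) + 2 := by linarith
  have hDR : (0 : ℝ) < D := by exact_mod_cast hD0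
  have hEr : (1 : ℝ) < ((d : ℝ) + 2) ^ 2 := by nlinarith only [hd']
  have h1E : 0 < 1 - 1 / ((d : ℝ) + 2) ^ 2 := by
    rw [sub_pos, div_lt_one (by positivity)]; exact hEr
  have main := discharge hD I hI (κ := 1 / ((1 - 1 / ((d : ℝ) + 2) ^ 2) * D))
    (η := 1 / ((d : ℝ) + 2) ^ 2) (β := β) (by positivity) (by positivity) hβ0
    (D - D / E) (S) (by
      intro x hx
      by_cases c1 : G.degree x < S
      · right; right
        refine ⟨c1, ?_⟩
        set m := (G.degree x : ℝ) ^ ((1 : ℝ) / 3) with hm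
        have hm3 : m ^ 3 = G.degree x := cube_root_facts (by positivity)
        have := low_sum hnc hcol hD hs c1 (hd.trans (hmin x)) (Real.rpow_nonneg (by positivity) _) hm3
        have htm : t ≤ m := Real.rpow_le_rpow (by linarith) (by exact_mod_cast hmin x) (by norm_num)
        calc 1 ≤ β * (1.2 * t) := hβ1
          _ ≤ β * (1.2 * m) := by gcongr
          _ ≤ _ := by gcongr
      · by_cases c2 : G.degree x < D - D / E
        · right; left
          refine ⟨c2, ?_⟩
          have := mid_rows hnc hcol hD hE0 hE0 h8 (h3584.trans_le (not_lt.1 c1)) c2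
          rw [hER] at this
          rw [one_div, ← div_eq_inv_mul, le_div_iff₀ (by positivity), one_mul]
          exact this
        · left
          rw [one_div, ← div_eq_inv_mul, le_div_iff₀ (by positivity), one_mul]
          have e1 : ((D / E : ℕ) : ℝ) ≤ (D : ℝ) / ((d : ℝ) + 2) ^ 2 := by
            have := Nat.cast_div_le (α := ℝ) (m := D) (n := E)
            rw [hER] at this
            exact this
          have e2 : D ≤ G.degree x + D / E := by omega
          have e3 : (D : ℝ) ≤ G.degree x + ((D / E : ℕ) : ℝ) := by exact_mod_cast e2
          have e4 : (1 - 1 / ((d : ℝ) + 2) ^ 2) * D = D - (D : ℝ) / ((d : ℝ) + 2) ^ 2 := by ring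
          rw [e4]; linarith)
  have hJ : (0 : ℝ) < Iᶜ.card := by
    have : Iᶜ.Nonempty := by
      obtain ⟨v⟩ := hconn.nonempty
      by_cases hv : v ∈ I
      · have : 0 < G.degree v := by have := hmin v; omega
        rw [← SimpleGraph.card_neighborFinset_eq_degree, Finset.card_pos] at this
        obtain ⟨u, hu⟩ := this
        have hvu := (SimpleGraph.mem_neighborFinset G v u).1 hu
        exact ⟨u, Finset.mem_compl.2 (fun hu' => hI v hv u hu' hvu.ne hvu)⟩
      · exact ⟨v, Finset.mem_compl.2 hv⟩
    exact_mod_cast Finset.card_pos.2 this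
  have hC : 1 / ((1 - 1 / ((d : ℝ) + 2) ^ 2) * D) * D + 1 / ((d : ℝ) + 2) ^ 2 + β <
      1 + c / ((d : ℝ) + 2) := by
    have e1 : 1 / ((1 - 1 / ((d : ℝ) + 2) ^ 2) * D) * D = 1 / (1 - 1 / ((d : ℝ) + 2) ^ 2) := by
      field_simp
    set e := 1 / ((d : ℝ) + 2) ^ 2 with he
    have he0 : 0 < e := by positivity
    have heh : e < 1 / 2 := by
      rw [he]
      refine one_div_lt_one_div_of_lt (by norm_num) ?_
      nlinarith only [hd']
    have e2 : 3 / ((d : ℝ) + 2) ^ 2 = 3 * e := by rw [he]; ring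
    have e3 : 1 / (1 - e) < 1 + 2 * e := by
      rw [div_lt_iff₀ h1E]
      nlinarith only [he0, heh]
    rw [e1, hβ, e2]
    linarith
  have hlt : (I.card : ℝ) < Iᶜ.card * (1 + c / ((d : ℝ) + 2)) :=
    main.trans_lt (mul_lt_mul_of_pos_left hC hJ)
  have hn : (Fintype.card V : ℝ) = I.card + Iᶜ.card := by
    exact_mod_cast (Finset.card_add_card_compl I).symm
  rw [← hIc, hn, div_mul_eq_mul_div, lt_div_iff₀ (by positivity)]
  have e5 : (Iᶜ.card : ℝ) * (1 + c / ((d : ℝ) + 2)) * ((d : ℝ) + 2) =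
      Iᶜ.card * ((d : ℝ) + 2 + c) := by field_simp
  have e6 := mul_lt_mul_of_pos_right hlt hN
  rw [e5] at e6
  linarith
end

section
/- Let ε, λ ∈ (0,1), let Δ be a real number with Δ ≥ D₀, and let q = (1−ε)Δ. If G is a Δ-critical simple graph, xy ∈ E(G) with d(x) < q, and φ ∈ C^Δ(G−xy), then except for at most N vertices in N(x, M_φ), every other vertex z ∈ N(x, M_φ) satisfies |φ_b(z) − {φ(xz)}| < λΔ. -/
open Finset

variable {V : Type*}

/-- The set of colors present at `v` in the graph `H` under the coloring `φ`. -/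
def present (H : SimpleGraph V) (φ : V → V → ℕ) (v : V) : Set ℕ :=
  {c | ∃ u, H.Adj v u ∧ φ v u = c}

/-- The set of colors in `[1,Δ]` missing at `v` in the graph `H` under the coloring `φ`. -/
def missing (H : SimpleGraph V) (Δ : ℕ) (φ : V → V → ℕ) (v : V) : Set ℕ :=
  Set.Icc 1 Δ \ present H φ v

variable [Fintype V]

/-- `A_φ(x,y,q)`: colors `α` present at `x` such that some colored edge `yu` has color `α`
with `d(u) < q` (degrees taken in `G`, the coloring living on `H = G - xy`). -/
def Aset (G H : SimpleGraph V) [DecidableRel G.Adj] (φ : V → V → ℕ) (q : ℝ) (x y : V) :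
    Set ℕ :=
  {α | α ∈ present H φ x ∧ ∃ u, H.Adj y u ∧ φ y u = α ∧ (G.degree u : ℝ) < q}

/-- `B_φ(x,y,q)`: colors `β` present at `x` such that some colored edge `yu` has color `β`
with `d(u) ≥ q`. -/
def Bset (G H : SimpleGraph V) [DecidableRel G.Adj] (φ : V → V → ℕ) (q : ℝ) (x y : V) :
    Set ℕ :=
  {β | β ∈ present H φ x ∧ ∃ u, H.Adj y u ∧ φ y u = β ∧ q ≤ (G.degree u : ℝ)}

/-- `M_φ(x,y,q) = A_φ(x,y,q) ∪ φ̄(x) ∪ φ̄(y)`. -/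
def Mset (G H : SimpleGraph V) [DecidableRel G.Adj] (Δ : ℕ) (φ : V → V → ℕ) (q : ℝ)
    (x y : V) : Set ℕ :=
  Aset G H φ q x y ∪ missing H Δ φ x ∪ missing H Δ φ y

/-- `N(x, M_φ)`: neighbors `z` of `x` (in `H = G - xy`) with `φ(xz) ∈ M_φ(x,y,q)`. -/
def NxM (G H : SimpleGraph V) [DecidableRel G.Adj] (Δ : ℕ) (φ : V → V → ℕ) (q : ℝ)
    (x y : V) : Set V :=
  {z | H.Adj x z ∧ φ x z ∈ Mset G H Δ φ q x y}

/-- `N(x, B_φ)`: neighbors `z` of `x` (in `H = G - xy`) with `φ(xz) ∈ B_φ(x,y,q)`. -/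
def NxB (G H : SimpleGraph V) [DecidableRel G.Adj] (φ : V → V → ℕ) (q : ℝ) (x y : V) :
    Set V :=
  {z | H.Adj x z ∧ φ x z ∈ Bset G H φ q x y}

/-- `φ_b(v)`: colors `α ∈ [1,Δ]` that are either missing at `v`, or appear on a colored edge
`vv'` with `d(v') < q`. -/
def phib (G H : SimpleGraph V) [DecidableRel G.Adj] (Δ : ℕ) (φ : V → V → ℕ) (q : ℝ)
    (v : V) : Set ℕ :=
  {α | α ∈ Set.Icc 1 Δ ∧
    (α ∉ present H φ v ∨ ∃ v', H.Adj v v' ∧ φ v v' = α ∧ (G.degree v' : ℝ) < q)}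

section Helpers

/-- In a graph of maximum degree at most two, no component has three vertices of degree ≤ 1. -/
lemma three_ends_s6 (K : SimpleGraph V) (d2 : ∀ v (s : Finset V), (∀ u ∈ s, K.Adj v u) → s.card ≤ 2)
    {p₁ p₂ p₃ : V} (h12 : p₁ ≠ p₂) (h13 : p₁ ≠ p₃) (h23 : p₂ ≠ p₃)
    (d1 : ∀ v, v = p₁ ∨ v = p₂ ∨ v = p₃ → ∀ (s : Finset V), (∀ u ∈ s, K.Adj v u) → s.card ≤ 1)
    (r2 : K.Reachable p₁ p₂) (r3 : K.Reachable p₁ p₃) : False := by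
  classical
  let C := K.connectedComponentMk p₁
  let K' := C.toSimpleGraph
  have hconn : K'.Connected := C.connected_toSimpleGraph
  have hcard := hconn.card_vert_le_card_edgeSet_add_one
  have hsum := K'.sum_degrees_eq_twice_card_edges
  have m1 : p₁ ∈ C.supp := rfl
  have m2 : p₂ ∈ C.supp := by
    rw [SimpleGraph.ConnectedComponent.mem_supp_iff]
    exact SimpleGraph.ConnectedComponent.eq.2 r2.symm
  have m3 : p₃ ∈ C.supp := by
    rw [SimpleGraph.ConnectedComponent.mem_supp_iff]
    exact SimpleGraph.ConnectedComponent.eq.2 r3.symm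
  let T : Finset C := {⟨p₁, m1⟩, ⟨p₂, m2⟩, ⟨p₃, m3⟩}
  have hT : T.card = 3 := by
    rw [Finset.card_eq_three]
    exact ⟨_, _, _, by simpa using h12, by simpa using h13, by simpa using h23, rfl⟩
  have hdeg : ∀ v : C, K'.degree v + (if v ∈ T then 1 else 0) ≤ 2 := by
    intro v
    have hc : K'.degree v = ((K'.neighborFinset v).map ⟨Subtype.val, Subtype.val_injective⟩).card := by
      rw [Finset.card_map, SimpleGraph.card_neighborFinset_eq_degree]
    have hadj : ∀ u ∈ (K'.neighborFinset v).map ⟨Subtype.val, Subtype.val_injective⟩,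
        K.Adj v.1 u := by
      intro u hu
      simp only [Finset.mem_map, SimpleGraph.mem_neighborFinset] at hu
      obtain ⟨a, ha, rfl⟩ := hu
      exact ha
    split_ifs with hv
    · have : v.1 = p₁ ∨ v.1 = p₂ ∨ v.1 = p₃ := by
        simp only [T, Finset.mem_insert, Finset.mem_singleton] at hv
        rcases hv with h | h | h <;> simp [h]
      have := d1 _ this _ hadj
      omega
    · have := d2 _ _ hadj
      omega
  have h1 : ∑ v : C, (K'.degree v + (if v ∈ T then 1 else 0)) ≤ ∑ v : C, 2 :=
    Finset.sum_le_sum (fun v _ => hdeg v)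
  rw [Finset.sum_add_distrib] at h1
  simp only [Finset.sum_ite_mem, Finset.univ_inter, Finset.sum_const, smul_eq_mul, mul_one,
    Finset.card_univ] at h1
  rw [Nat.card_eq_fintype_card, Nat.card_eq_fintype_card, ← SimpleGraph.edgeFinset_card] at hcard
  omega


/-- Kempe graph of colors `a`, `b`. -/
def kempe (H : SimpleGraph V) (φ : V → V → ℕ) (hs : ∀ u v, φ u v = φ v u) (a b : ℕ) :
    SimpleGraph V where
  Adj u v := H.Adj u v ∧ (φ u v = a ∨ φ u v = b)
  symm := ⟨fun u v h => ⟨h.1.symm, by rw [hs v u]; exact h.2⟩⟩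
  loopless := ⟨fun u h => h.1.ne rfl⟩

lemma kempe_three {H : SimpleGraph V} {k : ℕ} {φ : V → V → ℕ} (hφ : IsEdgeColoring H k φ)
    {a b : ℕ} {p₁ p₂ p₃ : V} (h12 : p₁ ≠ p₂) (h13 : p₁ ≠ p₃) (h23 : p₂ ≠ p₃)
    (d1 : a ∉ present H φ p₁ ∨ b ∉ present H φ p₁)
    (d2 : a ∉ present H φ p₂ ∨ b ∉ present H φ p₂)
    (d3 : a ∉ present H φ p₃ ∨ b ∉ present H φ p₃)
    (r2 : (kempe H φ hφ.1 a b).Reachable p₁ p₂) (r3 : (kempe H φ hφ.1 a b).Reachable p₁ p₃) :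
    False := by
  classical
  have key : ∀ v (s : Finset V), (∀ u ∈ s, (kempe H φ hφ.1 a b).Adj v u) →
      ∀ t : Finset ℕ, (∀ u ∈ s, φ v u ∈ t) → s.card ≤ t.card := by
    intro v s hs t ht
    apply Finset.card_le_card_of_injOn (fun u => φ v u) ht
    intro u hu u' hu' h
    by_contra hne
    exact hφ.2.2 (hs u hu).1 (hs u' hu').1 hne h
  refine three_ends_s6 (kempe H φ hφ.1 a b) ?_ h12 h13 h23 ?_ r2 r3
  · intro v s hs
    refine (key v s hs {a, b} ?_).trans Finset.card_le_two
    intro u hu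
    simpa using (hs u hu).2
  · intro v hv s hs
    have : a ∉ present H φ v ∨ b ∉ present H φ v := by
      rcases hv with rfl | rfl | rfl <;> assumption
    rcases this with h | h
    · refine (key v s hs {b} ?_).trans (by simp)
      intro u hu
      have h2 := hs u hu
      rcases h2.2 with h3 | h3
      · exact absurd ⟨u, h2.1, h3⟩ h
      · simpa using h3
    · refine (key v s hs {a} ?_).trans (by simp)
      intro u hu
      have h2 := hs u hu
      rcases h2.2 with h3 | h3
      · simpa using h3
      · exact absurd ⟨u, h2.1, h3⟩ h

/-- Swapping colors `a`, `b` on a union `S` of Kempe components. -/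
lemma kempe_swap {H : SimpleGraph V} {k : ℕ} {φ : V → V → ℕ} (hφ : IsEdgeColoring H k φ)
    {a b : ℕ} (ha : a ∈ Set.Icc 1 k) (hb : b ∈ Set.Icc 1 k) (S : Set V)
    (hS : ∀ u v, (kempe H φ hφ.1 a b).Adj u v → u ∈ S → v ∈ S) :
    ∃ ψ, IsEdgeColoring H k ψ ∧ (∀ u v, H.Adj u v → u ∉ S → ψ u v = φ u v) ∧
      (∀ u v, H.Adj u v → u ∈ S → ψ u v = Equiv.swap a b (φ u v)) ∧
      (∀ u v c, c ≠ a → c ≠ b → (ψ u v = c ↔ φ u v = c)) := by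
  classical
  have sw : ∀ n c, c ≠ a → c ≠ b → (Equiv.swap a b n = c ↔ n = c) := by
    intro n c h1 h2
    rw [Equiv.swap_apply_eq_iff, Equiv.swap_apply_of_ne_of_ne h1 h2]
  have hin : ∀ u v, H.Adj u v → u ∈ S →
      (if u ∈ S ∧ v ∈ S then Equiv.swap a b (φ u v) else φ u v) = Equiv.swap a b (φ u v) := by
    intro u v h hu
    split_ifs with h1
    · rfl
    · have h2 : ¬ (φ u v = a ∨ φ u v = b) := fun h3 => h1 ⟨hu, hS u v ⟨h, h3⟩ hu⟩
      push Not at h2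
      rw [Equiv.swap_apply_of_ne_of_ne h2.1 h2.2]
  refine ⟨fun u v => if u ∈ S ∧ v ∈ S then Equiv.swap a b (φ u v) else φ u v,
    ⟨?_, ?_, ?_⟩, ?_, hin, ?_⟩
  · intro u v
    simp only [and_comm, hφ.1 u v]
  · intro u v h
    have h1 := hφ.2.1 h
    simp only
    split_ifs
    · rw [Equiv.swap_apply_def]
      split_ifs
      · simpa using hb
      · simpa using ha
      · exact h1
    · exact h1
  · intro v c d hc hd hne
    by_cases hv : v ∈ S
    · simp only [hin v c hc hv, hin v d hd hv]
      exact fun h => hφ.2.2 hc hd hne ((Equiv.swap a b).injective h)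
    · simp only [hv, false_and, if_false]
      exact hφ.2.2 hc hd hne
  · intro u v _ hu
    simp [hu]
  · intro u v c h1 h2
    simp only
    split_ifs
    · exact sw _ _ h1 h2
    · rfl

/-- Coloring (or recoloring) the edge `uv` with `c`. -/
lemma exists_upd {H H' : SimpleGraph V} {k : ℕ} {φ : V → V → ℕ} (hφ : IsEdgeColoring H k φ)
    {u v : V} {c : ℕ} (hc : c ∈ Set.Icc 1 k) (huv : u ≠ v)
    (hH : ∀ a b, H'.Adj a b → s(a, b) ≠ s(u, v) → H.Adj a b)
    (hu : ∀ t, t ≠ v → H.Adj u t → φ u t ≠ c) (hv : ∀ t, t ≠ u → H.Adj v t → φ v t ≠ c) :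
    ∃ ψ, IsEdgeColoring H' k ψ ∧ ψ u v = c ∧ ∀ a b, s(a, b) ≠ s(u, v) → ψ a b = φ a b := by
  classical
  refine ⟨fun a b => if s(a, b) = s(u, v) then c else φ a b, ⟨?_, ?_, ?_⟩, by simp, ?_⟩
  · intro a b
    simp only [Sym2.eq_swap (a := a) (b := b), hφ.1 a b]
  · intro a b h
    simp only
    split_ifs with h1
    · simpa using hc
    · exact hφ.2.1 (hH a b h h1)
  · intro w a b ha hb hne
    simp only
    split_ifs with h1 h2 h2
    · exfalso
      rw [← h1] at h2
      exact hne ((Sym2.congr_right.1 h2).symm)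
    · have hb' := hH _ _ hb h2
      rw [Sym2.eq_iff] at h1
      rcases h1 with ⟨rfl, rfl⟩ | ⟨rfl, rfl⟩
      · exact (hu b hne.symm hb').symm
      · exact (hv b hne.symm hb').symm
    · have ha' := hH _ _ ha h1
      rw [Sym2.eq_iff] at h2
      rcases h2 with ⟨rfl, rfl⟩ | ⟨rfl, rfl⟩
      · exact hu a hne ha'
      · exact hv a hne ha'
    · exact hφ.2.2 (hH _ _ ha h1) (hH _ _ hb h2) hne
  · intro a b h
    simp only [h, if_false]

lemma swap_miss {H : SimpleGraph V} {φ ψ : V → V → ℕ} {a b : ℕ} {v : V}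
    (h : ∀ u, H.Adj v u → ψ v u = Equiv.swap a b (φ v u)) (hb : b ∉ present H φ v) :
    a ∉ present H ψ v := by
  rintro ⟨u, hu, h1⟩
  rw [h u hu, Equiv.swap_apply_eq_iff, Equiv.swap_apply_left] at h1
  exact hb ⟨u, hu, h1⟩

lemma same_miss {H : SimpleGraph V} {φ ψ : V → V → ℕ} {c : ℕ} {v : V}
    (h : ∀ u, H.Adj v u → ψ v u = c → φ v u = c) (hb : c ∉ present H φ v) :
    c ∉ present H ψ v := by
  rintro ⟨u, hu, h1⟩
  exact hb ⟨u, hu, h u hu h1⟩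

lemma reach_closed (K : SimpleGraph V) (p : V) :
    ∀ u v, K.Adj u v → u ∈ {v | K.Reachable p v} → v ∈ {v | K.Reachable p v} :=
  fun _ _ h hu => SimpleGraph.Reachable.trans hu h.reachable

lemma no_common {G H : SimpleGraph V} {k : ℕ} {x y : V} (hne : x ≠ y)
    (hH : ∀ a b, G.Adj a b → s(a, b) ≠ s(x, y) → H.Adj a b)
    (hno : ∀ ψ, ¬ IsEdgeColoring G k ψ) {φ : V → V → ℕ} (hφ : IsEdgeColoring H k φ) {c : ℕ}
    (hcx : c ∈ missing H k φ x) (hcy : c ∈ missing H k φ y) : False := by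
  obtain ⟨ψ, hψ, -⟩ := exists_upd (H' := G) hφ hcx.1 hne hH
    (fun t _ ht h => hcx.2 ⟨t, ht, h⟩) (fun t _ ht h => hcy.2 ⟨t, ht, h⟩)
  exact hno ψ hψ

lemma linked {G H : SimpleGraph V} {k : ℕ} {x y : V} (hne : x ≠ y)
    (hH : ∀ a b, G.Adj a b → s(a, b) ≠ s(x, y) → H.Adj a b)
    (hno : ∀ ψ, ¬ IsEdgeColoring G k ψ) {φ : V → V → ℕ} (hφ : IsEdgeColoring H k φ) {a b : ℕ}
    (hcx : b ∈ missing H k φ x) (hcy : a ∈ missing H k φ y) :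
    (kempe H φ hφ.1 a b).Reachable x y := by
  by_contra hr
  obtain ⟨ψ, hψ, h1, h2, -⟩ := kempe_swap hφ hcy.1 hcx.1 _
    (reach_closed (kempe H φ hφ.1 a b) x)
  refine no_common hne hH hno hψ (c := a) ⟨hcy.1, ?_⟩ ⟨hcy.1, ?_⟩
  · exact swap_miss (fun u hu => h2 x u hu (SimpleGraph.Reachable.refl x)) hcx.2
  · exact same_miss (fun u hu h => by rw [← h1 y u hu hr]; exact h) hcy.2

/-- The final contradiction. -/
lemma final_contra {G H : SimpleGraph V} {k : ℕ} {x y : V} (hne : x ≠ y)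
    (hH : ∀ a b, G.Adj a b → s(a, b) ≠ s(x, y) → H.Adj a b) (hxy : ¬ H.Adj x y)
    (hno : ∀ ψ, ¬ IsEdgeColoring G k ψ) {φ : V → V → ℕ} (hφ : IsEdgeColoring H k φ)
    {z : V} {c g : ℕ} (hxz : H.Adj x z) (ha : φ x z ∈ missing H k φ y)
    (hcx : c ∈ missing H k φ x) (hgx : g ∈ missing H k φ x)
    (hw : c ∉ present H φ z ∨ ∃ w, H.Adj z w ∧ φ z w = c ∧ g ∉ present H φ w) : False := by
  have hzy : z ≠ y := by rintro rfl; exact hxy hxz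
  have hac : φ x z ≠ c := fun h => hcx.2 ⟨z, hxz, h⟩
  have hag : φ x z ≠ g := fun h => hgx.2 ⟨z, hxz, h⟩
  rcases hw with hz | ⟨w, hzw, hcw, hgw⟩
  · obtain ⟨ψ, hψ, h1, h2⟩ := exists_upd (H' := H) hφ hcx.1 hxz.ne (fun _ _ h _ => h)
      (fun t _ ht h => hcx.2 ⟨t, ht, h⟩) (fun t _ ht h => hz ⟨t, ht, h⟩)
    refine no_common hne hH hno hψ (c := φ x z) ⟨ha.1, ?_⟩ ⟨ha.1, ?_⟩
    · rintro ⟨u, hu, h⟩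
      by_cases huz : u = z
      · subst huz; rw [h1] at h; exact hac h.symm
      · rw [h2 _ _ (fun h => huz (Sym2.congr_right.1 h))] at h
        exact hφ.2.2 hu hxz huz h
    · refine same_miss (fun u hu h => ?_) ha.2
      rw [h2 _ _ ?_] at h
      · exact h
      · rw [Ne, Sym2.eq_iff]
        rintro (⟨h, -⟩ | ⟨h, -⟩)
        · exact hne h.symm
        · exact hzy h.symm
  · have hwx : w ≠ x := by
      rintro rfl
      rw [hφ.1] at hcw; exact hac hcw
    have hwy : w ≠ y := by
      rintro rfl
      exact no_common hne hH hno hφ hgx ⟨hgx.1, hgw⟩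
    have hr := linked hne hH hno hφ hgx ha
    have hrw : ¬ (kempe H φ hφ.1 (φ x z) g).Reachable x w := fun h =>
      kempe_three hφ hne hwx.symm hwy.symm (Or.inr hgx.2) (Or.inl ha.2) (Or.inr hgw) hr h
    have hrz : (kempe H φ hφ.1 (φ x z) g).Reachable x z :=
      SimpleGraph.Adj.reachable ⟨hxz, Or.inl rfl⟩
    obtain ⟨ψ, hψ, h1, h2, h3⟩ := kempe_swap hφ ha.1 hgx.1 _
      (reach_closed (kempe H φ hφ.1 (φ x z) g) w)
    have hsx : ∀ u, H.Adj x u → ψ x u = φ x u := fun u hu => h1 x u hu (fun h => hrw h.symm)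
    have hsy : ∀ u, H.Adj y u → ψ y u = φ y u :=
      fun u hu => h1 y u hu (fun h => hrw (hr.trans h.symm))
    have hsz : ∀ u, H.Adj z u → ψ z u = φ z u :=
      fun u hu => h1 z u hu (fun h => hrw (hrz.trans h.symm))
    have haw : φ x z ∉ present H ψ w :=
      swap_miss (fun u hu => h2 w u hu (SimpleGraph.Reachable.refl w)) hgw
    -- uncolor `zw`
    have hψ0 : IsEdgeColoring (H.deleteEdges {s(z, w)}) k ψ := by
      refine ⟨hψ.1, fun u v h => hψ.2.1 (SimpleGraph.deleteEdges_le _ h), fun v a b h h' => ?_⟩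
      exact hψ.2.2 (SimpleGraph.deleteEdges_le _ h) (SimpleGraph.deleteEdges_le _ h')
    obtain ⟨ψ1, hψ1, k1, k2⟩ := exists_upd (H' := H.deleteEdges {s(z, w)}) hψ0 hcx.1 hxz.ne
      (fun _ _ h _ => h)
      (fun t _ ht h => by
        have ht' := SimpleGraph.deleteEdges_le _ ht
        rw [hsx t ht'] at h
        exact hcx.2 ⟨t, ht', h⟩)
      (fun t _ ht h => by
        rw [SimpleGraph.deleteEdges_adj] at ht
        rw [hsz t ht.1] at h
        have : t ≠ w := by rintro rfl; exact ht.2 rfl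
        exact hφ.2.2 ht.1 hzw this (h.trans hcw.symm))
    obtain ⟨ψ2, hψ2, l1, l2⟩ := exists_upd (H' := H) (c := φ x z) hψ1 ha.1 hzw.ne
      (fun a b h h' => by rw [SimpleGraph.deleteEdges_adj]; exact ⟨h, h'⟩)
      (fun t htw ht h => by
        rw [SimpleGraph.deleteEdges_adj] at ht
        by_cases htx : t = x
        · subst htx
          rw [hψ1.1, k1] at h
          exact hac h.symm
        · rw [k2 _ _ (by rw [Sym2.eq_swap (a := x)]; exact fun h => htx (Sym2.congr_right.1 h)),
            hsz t ht.1] at h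
          rw [hφ.1 x z] at h
          exact hφ.2.2 ht.1 hxz.symm htx h)
      (fun t htz ht h => by
        have ht' := SimpleGraph.deleteEdges_le _ ht
        rw [k2] at h
        · exact haw ⟨t, ht', h⟩
        · rw [Ne, Sym2.eq_iff]
          rintro (⟨h, -⟩ | ⟨h, -⟩)
          · exact hwx h
          · exact hzw.ne h.symm)
    refine no_common hne hH hno hψ2 (c := φ x z) ⟨ha.1, ?_⟩ ⟨ha.1, ?_⟩
    · rintro ⟨u, hu, h⟩
      rw [l2] at h
      · by_cases huz : u = z
        · subst huz; rw [k1] at h; exact hac h.symm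
        · rw [k2 _ _ (fun h => huz (Sym2.congr_right.1 h)), hsx u hu] at h
          exact hφ.2.2 hu hxz huz h
      · rw [Ne, Sym2.eq_iff]
        rintro (⟨h, -⟩ | ⟨h, -⟩)
        · exact hxz.ne h
        · exact hwx h.symm
    · rintro ⟨u, hu, h⟩
      rw [l2, k2, hsy u hu] at h
      · exact ha.2 ⟨u, hu, h⟩
      · rw [Ne, Sym2.eq_iff]
        rintro (⟨h, -⟩ | ⟨h, -⟩)
        · exact hne h.symm
        · exact hzy h.symm
      · rw [Ne, Sym2.eq_iff]
        rintro (⟨h, -⟩ | ⟨h, -⟩)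
        · exact hzy h.symm
        · exact hwy h.symm

open Classical in
/-- Finset of missing colors. -/
noncomputable def missF (H : SimpleGraph V) (k : ℕ) (φ : V → V → ℕ) (v : V) : Finset ℕ :=
  (Finset.Icc 1 k).filter (fun c => c ∉ present H φ v)

lemma mem_missF {H : SimpleGraph V} {k : ℕ} {φ : V → V → ℕ} {v : V} {c : ℕ} :
    c ∈ missF H k φ v ↔ c ∈ Finset.Icc 1 k ∧ c ∉ present H φ v := by
  classical
  simp [missF]

lemma low_card {G H : SimpleGraph V} [DecidableRel G.Adj] (hHG : ∀ a b, H.Adj a b → G.Adj a b)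
    (k : ℕ) (φ : V → V → ℕ) (w : V) : (k : ℝ) - G.degree w ≤ (missF H k φ w).card := by
  classical
  have h1 : Finset.Icc 1 k \ (G.neighborFinset w).image (φ w) ⊆ missF H k φ w := by
    intro c hc
    rw [Finset.mem_sdiff] at hc
    refine mem_missF.2 ⟨hc.1, ?_⟩
    rintro ⟨u, hu, rfl⟩
    exact hc.2 (Finset.mem_image_of_mem _ (by simpa using hHG _ _ hu))
  have h2 := Finset.card_le_card h1
  have h3 := Finset.le_card_sdiff ((G.neighborFinset w).image (φ w)) (Finset.Icc 1 k)
  have h4 : ((G.neighborFinset w).image (φ w)).card ≤ G.degree w := by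
    rw [← SimpleGraph.card_neighborFinset_eq_degree]
    exact Finset.card_image_le
  have h5 : (Finset.Icc 1 k).card = k := by simp
  have : k ≤ (missF H k φ w).card + G.degree w := by omega
  have : (k : ℝ) ≤ (missF H k φ w).card + G.degree w := by exact_mod_cast this
  linarith

lemma popular (Z : Finset V) (k : ℕ) (hk : 0 < k) (r : ℝ) (T : V → Finset ℕ)
    (hT : ∀ z ∈ Z, T z ⊆ Finset.Icc 1 k) (hr : ∀ z ∈ Z, r * k ≤ (T z).card) :
    ∃ b ∈ Finset.Icc 1 k, r * Z.card ≤ ((Z.filter (fun z => b ∈ T z)).card : ℝ) := by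
  classical
  apply Finset.exists_le_of_sum_le (Finset.nonempty_Icc.2 hk)
  have h1 : ∑ b ∈ Finset.Icc 1 k, (((Z.filter (fun z => b ∈ T z)).card : ℕ) : ℝ)
      = ∑ z ∈ Z, ((T z).card : ℝ) := by
    have : ∑ b ∈ Finset.Icc 1 k, (Z.filter (fun z => b ∈ T z)).card = ∑ z ∈ Z, (T z).card := by
      simp only [Finset.card_filter]
      rw [Finset.sum_comm]
      refine Finset.sum_congr rfl fun z hz => ?_
      rw [← Finset.card_filter]
      congr 1
      ext b
      simp only [Finset.mem_filter]
      exact ⟨fun h => h.2, fun h => ⟨hT z hz h, h⟩⟩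
    exact_mod_cast this
  rw [h1]
  have h2 := Finset.sum_le_sum hr
  simp only [Finset.sum_const, nsmul_eq_mul, Nat.card_Icc, Nat.add_sub_cancel] at h2 ⊢
  linarith

lemma mem_M_of_same {G H : SimpleGraph V} [DecidableRel G.Adj] {k : ℕ} {φ ψ : V → V → ℕ} {q : ℝ}
    {x y z : V} (hxz : H.Adj x z) (hM : φ x z ∈ Mset G H k φ q x y)
    (h : ∀ u v, ψ u v = φ x z ↔ φ u v = φ x z) : ψ x z ∈ Mset G H k ψ q x y := by
  have e : ψ x z = φ x z := (h x z).2 rfl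
  rw [e]
  rcases hM with (hA | hx) | hy
  · obtain ⟨-, u, hu, h1, h2⟩ := hA
    exact Or.inl (Or.inl ⟨⟨z, hxz, e⟩, u, hu, (h _ _).2 h1, h2⟩)
  · exact absurd ⟨z, hxz, rfl⟩ hx.2
  · exact Or.inr ⟨hy.1, same_miss (fun u _ hu => (h _ _).1 hu) hy.2⟩

lemma missing_y {G H : SimpleGraph V} [DecidableRel G.Adj] {k : ℕ} {x y : V}
    (hHG : ∀ a b, H.Adj a b → G.Adj a b) (hxy : ¬ H.Adj x y) (hG : G.Adj x y)
    (hk : G.degree y ≤ k) (φ : V → V → ℕ) : ∃ e, e ∈ missing H k φ y := by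
  classical
  by_contra hcon
  push Not at hcon
  have h1 : Finset.Icc 1 k ⊆ ((G.neighborFinset y).erase x).image (φ y) := by
    intro c hc
    have : c ∈ present H φ y := by
      by_contra h
      exact hcon c ⟨by simpa using hc, h⟩
    obtain ⟨u, hu, rfl⟩ := this
    refine Finset.mem_image_of_mem _ (Finset.mem_erase.2 ⟨?_, by simpa using hHG _ _ hu⟩)
    rintro rfl
    exact hxy hu.symm
  have h2 := (Finset.card_le_card h1).trans Finset.card_image_le
  have hx : x ∈ G.neighborFinset y := by simpa using hG.symm
  rw [Finset.card_erase_of_mem hx, SimpleGraph.card_neighborFinset_eq_degree] at h2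
  have h3 : 0 < G.degree y := by
    rw [← SimpleGraph.card_neighborFinset_eq_degree]; exact Finset.card_pos.2 ⟨x, hx⟩
  simp at h2
  omega

lemma stageA {G H : SimpleGraph V} [DecidableRel G.Adj] {k c₀ : ℕ} {ε q : ℝ} {x y : V}
    (hne : x ≠ y) (hH : ∀ a b, G.Adj a b → s(a, b) ≠ s(x, y) → H.Adj a b)
    (hHG : ∀ a b, H.Adj a b → G.Adj a b) (hxy : ¬ H.Adj x y)
    (hno : ∀ ψ, ¬ IsEdgeColoring G k ψ) {φ : V → V → ℕ} (hφ : IsEdgeColoring H k φ)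
    (hy : ∃ e, e ∈ missing H k φ y) (hε : 1 ≤ (c₀ + 1) * ε) (hk : 2 * (c₀ + 2) < ε * k)
    (hq : q = (1 - ε) * k) {c g : ℕ}
    (hcx : c ∈ missing H k φ x) (hgx : g ∈ missing H k φ x)
    (Z : Finset V) (hZc : c₀ + 2 ≤ Z.card)
    (hZ : ∀ z ∈ Z, H.Adj x z ∧ φ x z ∈ Mset G H k φ q x y ∧
      (c ∉ present H φ z ∨ ∃ w, H.Adj z w ∧ φ z w = c ∧ g ∉ present H φ w)) : False := by
  classical
  obtain ⟨e, he⟩ := hy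
  have hu : ∀ z ∈ Z, ∃ u, H.Adj y u ∧ φ y u = φ x z ∧ (G.degree u : ℝ) < q := by
    intro z hz
    obtain ⟨h1, h2, h3⟩ := hZ z hz
    rcases h2 with (hA | hx) | hy
    · exact hA.2
    · exact absurd ⟨z, h1, rfl⟩ hx.2
    · exact (final_contra hne hH hxy hno hφ h1 hy hcx hgx h3).elim
  choose! u hu1 hu2 hu3 using hu
  -- the key claim
  have claim : ∀ b ∈ Set.Icc 1 k, b ≠ c → b ≠ g → ∀ z ∈ Z, b ∉ present H φ (u z) →
      ¬ (kempe H φ hφ.1 e b).Reachable y (u z) → False := by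
    intro b hb hbc hbg z hz hbu hr
    obtain ⟨h1, h2, h3⟩ := hZ z hz
    obtain ⟨ψ, hψ, k1, k2, k3⟩ := kempe_swap hφ he.1 hb _
      (reach_closed (kempe H φ hφ.1 e b) (u z))
    have eu : e ∉ present H ψ (u z) :=
      swap_miss (fun t ht => k2 _ t ht (SimpleGraph.Reachable.refl _)) hbu
    have sy : ∀ t, H.Adj y t → ψ y t = φ y t := fun t ht => k1 y t ht (fun h => hr h.symm)
    have ey : e ∉ present H ψ y := same_miss (fun t ht h => by rw [← sy t ht]; exact h) he.2
    have ae : φ x z ≠ e := fun h => he.2 ⟨u z, hu1 z hz, (hu2 z hz).trans h⟩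
    have ab : φ x z ≠ b := fun h => hbu ⟨y, (hu1 z hz).symm, by
      rw [hφ.1]; exact (hu2 z hz).trans h⟩
    obtain ⟨ψ2, hψ2, l1, l2⟩ := exists_upd (H' := H) hψ he.1 (hu1 z hz).ne (fun _ _ h _ => h)
      (fun t _ ht h => ey ⟨t, ht, h⟩) (fun t _ ht h => eu ⟨t, ht, h⟩)
    have key : ∀ d, d ≠ e → d ≠ b → d ≠ φ x z → ∀ a a', ψ2 a a' = d ↔ φ a a' = d := by
      intro d d1 d2 d3 a a'
      by_cases hs : s(a, a') = s(y, u z)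
      · have v1 : ψ2 a a' = e := by
          rw [Sym2.eq_iff] at hs
          rcases hs with ⟨rfl, rfl⟩ | ⟨rfl, rfl⟩
          · exact l1
          · rw [hψ2.1]; exact l1
        have v2 : φ a a' = φ x z := by
          rw [Sym2.eq_iff] at hs
          rcases hs with ⟨rfl, rfl⟩ | ⟨rfl, rfl⟩
          · exact hu2 z hz
          · rw [hφ.1]; exact hu2 z hz
        rw [v1, v2]
        exact ⟨fun h => absurd h.symm d1, fun h => absurd h.symm d3⟩
      · rw [l2 _ _ hs]
        exact k3 _ _ _ d1 d2
    have hxz : ψ2 x z = φ x z := by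
      rw [l2]
      · exact (k3 _ _ _ ae ab).2 rfl
      · rw [Ne, Sym2.eq_iff]
        rintro (⟨h, -⟩ | ⟨h, -⟩)
        · exact hne h
        · exact hxy (by have := (hu1 z hz).symm; rwa [← h] at this)
    have ay : φ x z ∉ present H ψ2 y := by
      rintro ⟨t, ht, h⟩
      by_cases htu : t = u z
      · rw [htu, l1] at h
        exact ae h.symm
      · rw [l2 _ _ (fun h => htu (Sym2.congr_right.1 h)), sy t ht] at h
        exact hφ.2.2 ht (hu1 z hz) htu (h.trans (hu2 z hz).symm)
    have keyx : ∀ d, d ∈ missing H k φ x → d ≠ b → ∀ a a', ψ2 a a' = d ↔ φ a a' = d := by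
      intro d hd hdb
      refine key d ?_ hdb ?_
      · rintro rfl
        exact no_common hne hH hno hφ hd he
      · rintro rfl
        exact hd.2 ⟨z, h1, rfl⟩
    have kc := keyx c hcx hbc.symm
    have kg := keyx g hgx hbg.symm
    refine final_contra hne hH hxy hno hψ2 (z := z) (c := c) (g := g) h1 ?_ ?_ ?_ ?_
    · rw [hxz]
      refine ⟨by simpa using hφ.2.1 h1, ay⟩
    · exact ⟨hcx.1, same_miss (fun t _ h => (kc _ _).1 h) hcx.2⟩
    · exact ⟨hgx.1, same_miss (fun t _ h => (kg _ _).1 h) hgx.2⟩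
    · rcases h3 with h3 | ⟨w, w1, w2, w3⟩
      · exact Or.inl (same_miss (fun t _ h => (kc _ _).1 h) h3)
      · exact Or.inr ⟨w, w1, (kc _ _).2 w2, same_miss (fun t _ h => (kg _ _).1 h) w3⟩
  -- pigeonhole
  let T : V → Finset ℕ := fun z => missF H k φ (u z) \ {c, g}
  have hTc : ∀ z ∈ Z, ε * k - 2 ≤ ((T z).card : ℝ) := by
    intro z hz
    have h1 := low_card hHG k φ (u z)
    have h2 := hu3 z hz
    have h3 := Finset.le_card_sdiff ({c, g} : Finset ℕ) (missF H k φ (u z))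
    have h4 : ({c, g} : Finset ℕ).card ≤ 2 := Finset.card_le_two
    have h5 : (missF H k φ (u z)).card ≤ (T z).card + 2 := by
      change _ ≤ (missF H k φ (u z) \ {c, g}).card + 2
      omega
    have h6 : ((missF H k φ (u z)).card : ℝ) ≤ (T z).card + 2 := by exact_mod_cast h5
    rw [hq] at h2
    linarith
  have hdis : ∃ z ∈ Z, ∃ z' ∈ Z, z ≠ z' ∧ ¬ Disjoint (T z) (T z') := by
    by_contra hcon
    push Not at hcon
    have h1 : (Z.biUnion T).card = ∑ z ∈ Z, (T z).card :=
      Finset.card_biUnion (fun z hz z' hz' h => hcon z hz z' hz' h)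
    have h2 : (Z.biUnion T).card ≤ k := by
      have : Z.biUnion T ⊆ Finset.Icc 1 k := by
        intro b hb
        rw [Finset.mem_biUnion] at hb
        obtain ⟨z, -, hb⟩ := hb
        exact (mem_missF.1 (Finset.mem_sdiff.1 hb).1).1
      simpa using Finset.card_le_card this
    have h3 : ((Z.card : ℕ) : ℝ) * (ε * k - 2) ≤ ∑ z ∈ Z, ((T z).card : ℝ) := by
      have := Finset.sum_le_sum hTc
      rwa [Finset.sum_const, nsmul_eq_mul] at this
    have h4 : ∑ z ∈ Z, ((T z).card : ℝ) ≤ k := by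
      rw [h1] at h2; exact_mod_cast h2
    have h5 : ((c₀ : ℝ) + 2) ≤ Z.card := by exact_mod_cast hZc
    have h6 : 0 ≤ ε * k - 2 := by
      have : (0 : ℝ) ≤ c₀ := Nat.cast_nonneg _
      linarith
    have h7 := mul_le_mul_of_nonneg_right h5 h6
    have h8 : (k : ℝ) ≤ (c₀ + 1) * ε * k := by
      have : (0 : ℝ) ≤ k := Nat.cast_nonneg _
      nlinarith
    nlinarith
  obtain ⟨z, hz, z', hz', hzz, hd⟩ := hdis
  rw [Finset.not_disjoint_iff] at hd
  obtain ⟨b, hb, hb'⟩ := hd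
  simp only [T, Finset.mem_sdiff, mem_missF, Finset.mem_insert, Finset.mem_singleton,
    not_or] at hb hb'
  have hbk : b ∈ Set.Icc 1 k := by simpa using hb.1.1
  have r1 : (kempe H φ hφ.1 e b).Reachable y (u z) := by
    by_contra h
    exact claim b hbk hb.2.1 hb.2.2 z hz hb.1.2 h
  have r2 : (kempe H φ hφ.1 e b).Reachable y (u z') := by
    by_contra h
    exact claim b hbk hb.2.1 hb.2.2 z' hz' hb'.1.2 h
  refine kempe_three hφ (hu1 z hz).ne (hu1 z' hz').ne ?_ (Or.inl he.2) (Or.inr hb.1.2)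
    (Or.inr hb'.1.2) r1 r2
  intro h
  have : φ x z = φ x z' := by rw [← hu2 z hz, ← hu2 z' hz', h]
  exact hφ.2.2 (hZ z hz).1 (hZ z' hz').1 hzz this

/-- A popular color step: make `g` missing at many of the low ends of `c`-edges. -/
lemma stagePop {G H : SimpleGraph V} [DecidableRel G.Adj] {k : ℕ} {ε q : ℝ} {x y : V}
    (hHG : ∀ a b, H.Adj a b → G.Adj a b)
    {φ : V → V → ℕ} (hφ : IsEdgeColoring H k φ) (hk : 0 < k)
    (hq : q = (1 - ε) * k) (hq1 : 1 ≤ q) {c g : ℕ} (hgx : g ∈ missing H k φ x) (hgc : g ≠ c)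
    (Z : Finset V)
    (hZ : ∀ z ∈ Z, H.Adj x z ∧ φ x z ∈ Mset G H k φ q x y ∧ φ x z ≠ c ∧
      (c ∉ present H φ z ∨ ∃ w, H.Adj z w ∧ φ z w = c ∧ (G.degree w : ℝ) < q)) :
    ∃ (ψ : V → V → ℕ) (Z' : Finset V), IsEdgeColoring H k ψ ∧ ε * Z.card - 2 ≤ (Z'.card : ℝ) ∧
      (∀ u v, ψ u v = c ↔ φ u v = c) ∧ g ∈ missing H k ψ x ∧
      ∀ z ∈ Z', H.Adj x z ∧ ψ x z ∈ Mset G H k ψ q x y ∧ ψ x z ≠ c ∧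
      (c ∉ present H ψ z ∨
        ∃ w, H.Adj z w ∧ ψ z w = c ∧ (G.degree w : ℝ) < q ∧ g ∉ present H ψ w) := by
  classical
  let T : V → Finset ℕ := fun z => (Finset.Icc 1 k).filter (fun b => b ≠ c ∧
    (c ∉ present H φ z ∨
      ∃ w, H.Adj z w ∧ φ z w = c ∧ (G.degree w : ℝ) < q ∧ b ∉ present H φ w))
  have hT : ∀ z ∈ Z, ε * k ≤ (T z).card := by
    intro z hz
    obtain ⟨-, -, -, h | ⟨w, w1, w2, w3⟩⟩ := hZ z hz
    · have h1 : (Finset.Icc 1 k).erase c ⊆ T z := by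
        intro b hb
        rw [Finset.mem_erase] at hb
        exact Finset.mem_filter.2 ⟨hb.2, hb.1, Or.inl h⟩
      have h2 := Finset.card_le_card h1
      have h3 := Finset.pred_card_le_card_erase (s := Finset.Icc 1 k) (a := c)
      have h4 : (Finset.Icc 1 k).card = k := by simp
      have h5 : k ≤ (T z).card + 1 := by omega
      have h6 : (k : ℝ) ≤ (T z).card + 1 := by exact_mod_cast h5
      rw [hq] at hq1
      linarith
    · have h1 : missF H k φ w ⊆ T z := by
        intro b hb
        rw [mem_missF] at hb
        refine Finset.mem_filter.2 ⟨hb.1, ?_, Or.inr ⟨w, w1, w2, w3, hb.2⟩⟩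
        rintro rfl
        exact hb.2 ⟨z, w1.symm, by rw [hφ.1]; exact w2⟩
      have h2 : ((missF H k φ w).card : ℝ) ≤ (T z).card := by
        exact_mod_cast Finset.card_le_card h1
      have h3 := low_card hHG k φ w
      rw [hq] at w3
      linarith
  obtain ⟨b, hb, hpop⟩ := popular Z k hk ε T (fun z _ => Finset.filter_subset _ _) hT
  have hbk : b ∈ Set.Icc 1 k := by simpa using hb
  set Z1 := Z.filter (fun z => b ∈ T z) with hZ1
  have hZ1' : ∀ z ∈ Z1, z ∈ Z ∧ b ≠ c ∧ (c ∉ present H φ z ∨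
      ∃ w, H.Adj z w ∧ φ z w = c ∧ (G.degree w : ℝ) < q ∧ b ∉ present H φ w) := by
    intro z hz
    rw [hZ1, Finset.mem_filter] at hz
    exact ⟨hz.1, (Finset.mem_filter.1 hz.2).2⟩
  by_cases hZ1e : Z1 = ∅
  · refine ⟨φ, ∅, hφ, ?_, fun _ _ => Iff.rfl, hgx, by simp⟩
    rw [hZ1e] at hpop
    simp only [Finset.card_empty, Nat.cast_zero] at hpop ⊢
    linarith
  have hbc : b ≠ c := by
    obtain ⟨z, hz⟩ := Finset.nonempty_iff_ne_empty.2 hZ1e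
    exact (hZ1' z hz).2.1
  set K := kempe H φ hφ.1 g b with hK
  let Z' := Z1.filter (fun z => φ x z ≠ b ∧ (c ∉ present H φ z ∨
      ∃ w, H.Adj z w ∧ φ z w = c ∧ (G.degree w : ℝ) < q ∧ b ∉ present H φ w ∧
        ¬ K.Reachable x w))
  let B1 := Z1.filter (fun z => φ x z = b)
  let B2 := Z1.filter (fun z => ∃ w, H.Adj z w ∧ φ z w = c ∧ b ∉ present H φ w ∧
        K.Reachable x w)
  have hsub : Z1 ⊆ Z' ∪ (B1 ∪ B2) := by
    intro z hz
    obtain ⟨h1, -, h3⟩ := hZ1' z hz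
    by_cases hxb : φ x z = b
    · exact Finset.mem_union_right _ (Finset.mem_union_left _ (Finset.mem_filter.2 ⟨hz, hxb⟩))
    · rcases h3 with h3 | ⟨w, w1, w2, w3, w4⟩
      · exact Finset.mem_union_left _ (Finset.mem_filter.2 ⟨hz, hxb, Or.inl h3⟩)
      · by_cases hr : K.Reachable x w
        · exact Finset.mem_union_right _ (Finset.mem_union_right _
            (Finset.mem_filter.2 ⟨hz, w, w1, w2, w4, hr⟩))
        · exact Finset.mem_union_left _
            (Finset.mem_filter.2 ⟨hz, hxb, Or.inr ⟨w, w1, w2, w3, w4, hr⟩⟩)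
  have hB1 : B1.card ≤ 1 := by
    rw [Finset.card_le_one]
    intro z hz z' hz'
    obtain ⟨h1, h2⟩ := Finset.mem_filter.1 hz
    obtain ⟨h1', h2'⟩ := Finset.mem_filter.1 hz'
    by_contra hne
    exact hφ.2.2 (hZ z (hZ1' z h1).1).1 (hZ z' (hZ1' z' h1').1).1 hne (h2.trans h2'.symm)
  have hB2 : B2.card ≤ 1 := by
    rw [Finset.card_le_one]
    intro z hz z' hz'
    obtain ⟨h1, w, w1, w2, w3, w4⟩ := Finset.mem_filter.1 hz
    obtain ⟨h1', w', w1', w2', w3', w4'⟩ := Finset.mem_filter.1 hz'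
    by_contra hne
    have ww : w ≠ w' := by
      rintro rfl
      exact hφ.2.2 w1.symm w1'.symm hne (by rw [hφ.1 w z, hφ.1 w z', w2, w2'])
    have xw : x ≠ w := by
      rintro rfl
      exact (hZ z (hZ1' z h1).1).2.2.1 (by rw [hφ.1]; exact w2)
    have xw' : x ≠ w' := by
      rintro rfl
      exact (hZ z' (hZ1' z' h1').1).2.2.1 (by rw [hφ.1]; exact w2')
    exact kempe_three hφ xw xw' ww (Or.inl hgx.2) (Or.inr w3) (Or.inr w3') w4 w4'
  have hcard : (Z1.card : ℝ) ≤ Z'.card + 2 := by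
    have h1 := Finset.card_le_card hsub
    have h2 := Finset.card_union_le Z' (B1 ∪ B2)
    have h3 := Finset.card_union_le B1 B2
    have : Z1.card ≤ Z'.card + 2 := by omega
    exact_mod_cast this
  let S : Set V := {v | ¬ K.Reachable x v ∧ ∃ w, b ∉ present H φ w ∧ g ∈ present H φ w ∧
    K.Reachable w v}
  have hS : ∀ u v, (kempe H φ hφ.1 g b).Adj u v → u ∈ S → v ∈ S := by
    rintro u v h ⟨h1, w, h2, h3, h4⟩
    have hr : K.Reachable u v := SimpleGraph.Adj.reachable h
    exact ⟨fun h5 => h1 (h5.trans hr.symm), w, h2, h3, h4.trans hr⟩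
  obtain ⟨ψ, hψ, k1, k2, k3⟩ := kempe_swap hφ hgx.1 hbk S hS
  have hxS : x ∉ S := fun h => h.1 (SimpleGraph.Reachable.refl x)
  have kc := fun u v => k3 u v c hgc.symm hbc.symm
  refine ⟨ψ, Z', hψ, by linarith, kc, ?_, ?_⟩
  · exact ⟨hgx.1, same_miss (fun t ht h => by rw [← k1 x t ht hxS]; exact h) hgx.2⟩
  · intro z hz
    obtain ⟨h1, hxb, h3⟩ := Finset.mem_filter.1 hz
    obtain ⟨hxz, hM, hxc, -⟩ := hZ z (hZ1' z h1).1
    have hxg : φ x z ≠ g := fun h => hgx.2 ⟨z, hxz, h⟩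
    refine ⟨hxz, mem_M_of_same hxz hM (fun u v => k3 u v _ hxg hxb),
      fun h => hxc ((kc _ _).1 h), ?_⟩
    rcases h3 with h3 | ⟨w, w1, w2, w3, w4, w5⟩
    · exact Or.inl (same_miss (fun t _ h => (kc _ _).1 h) h3)
    · refine Or.inr ⟨w, w1, (kc _ _).2 w2, w3, ?_⟩
      by_cases hwS : w ∈ S
      · exact swap_miss (fun t ht => k2 w t ht hwS) w4
      · have hg : g ∉ present H φ w := fun h =>
          hwS ⟨w5, w, w4, h, SimpleGraph.Reachable.refl w⟩
        exact same_miss (fun t ht h => by rw [← k1 w t ht hwS]; exact h) hg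

/-- Make `c` missing at `x`. -/
lemma stageB {G H : SimpleGraph V} [DecidableRel G.Adj] {k : ℕ} {q : ℝ} {x y : V}
    {φ : V → V → ℕ} (hφ : IsEdgeColoring H k φ) {c g : ℕ} (hgx : g ∈ missing H k φ x)
    (hck : c ∈ Set.Icc 1 k) (hcx : c ∈ present H φ x) (Z : Finset V)
    (hZ : ∀ z ∈ Z, H.Adj x z ∧ φ x z ∈ Mset G H k φ q x y ∧ φ x z ≠ c ∧
      (c ∉ present H φ z ∨
        ∃ w, H.Adj z w ∧ φ z w = c ∧ (G.degree w : ℝ) < q ∧ g ∉ present H φ w)) :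
    ∃ (ψ : V → V → ℕ) (Z' : Finset V), IsEdgeColoring H k ψ ∧ Z.card ≤ Z'.card + 1 ∧
      c ∈ missing H k ψ x ∧
      ∀ z ∈ Z', H.Adj x z ∧ ψ x z ∈ Mset G H k ψ q x y ∧ ψ x z ≠ c ∧
      (c ∉ present H ψ z ∨ ∃ w, H.Adj z w ∧ ψ z w = c ∧ (G.degree w : ℝ) < q) := by
  classical
  set K := kempe H φ hφ.1 c g with hK
  let E : V → V → Prop := fun z e => e ≠ x ∧ K.Reachable x e ∧
    ((e = z ∧ c ∉ present H φ z) ∨ (H.Adj z e ∧ φ z e = c ∧ g ∉ present H φ e))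
  let Z' := Z.filter (fun z => ¬ ∃ e, E z e)
  let B := Z.filter (fun z => ∃ e, E z e)
  have hcard : Z.card ≤ Z'.card + B.card := by
    have := Finset.card_filter_add_card_filter_not (s := Z) (fun z => ∃ e, E z e)
    change Z.card ≤ (Z.filter (fun z => ¬ ∃ e, E z e)).card + (Z.filter (fun z => ∃ e, E z e)).card
    omega
  have hB : B.card ≤ 1 := by
    rw [Finset.card_le_one]
    intro z hz z' hz'
    obtain ⟨-, e, e1, e2, e3⟩ := Finset.mem_filter.1 hz
    obtain ⟨-, e', e1', e2', e3'⟩ := Finset.mem_filter.1 hz'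
    by_contra hne
    have ee : e ≠ e' := by
      rintro rfl
      rcases e3 with ⟨rfl, h⟩ | ⟨h1, h2, h3⟩
      · rcases e3' with ⟨rfl, h'⟩ | ⟨h1', h2', h3'⟩
        · exact hne rfl
        · exact h ⟨z', h1'.symm, by rw [hφ.1]; exact h2'⟩
      · rcases e3' with ⟨rfl, h'⟩ | ⟨h1', h2', h3'⟩
        · exact h' ⟨z, h1.symm, by rw [hφ.1]; exact h2⟩
        · exact hφ.2.2 h1.symm h1'.symm hne (by rw [hφ.1 e z, hφ.1 e z', h2, h2'])
    refine kempe_three hφ e1.symm e1'.symm ee (Or.inr hgx.2) ?_ ?_ e2 e2'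
    · rcases e3 with ⟨rfl, h⟩ | ⟨h1, h2, h3⟩
      · exact Or.inl h
      · exact Or.inr h3
    · rcases e3' with ⟨rfl, h⟩ | ⟨h1, h2, h3⟩
      · exact Or.inl h
      · exact Or.inr h3
  obtain ⟨ψ, hψ, k1, k2, k3⟩ := kempe_swap hφ hck hgx.1 _ (reach_closed K x)
  refine ⟨ψ, Z', hψ, by omega, ⟨hck, ?_⟩, ?_⟩
  · exact swap_miss (fun t ht => k2 x t ht (SimpleGraph.Reachable.refl x)) hgx.2
  · intro z hz
    obtain ⟨h1, h2⟩ := Finset.mem_filter.1 hz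
    obtain ⟨hxz, hM, hxc, h3⟩ := hZ z h1
    have hxg : φ x z ≠ g := fun h => hgx.2 ⟨z, hxz, h⟩
    have hk := fun u v => k3 u v _ hxc hxg
    refine ⟨hxz, mem_M_of_same hxz hM hk, by rw [(hk x z).2 rfl]; exact hxc, ?_⟩
    rcases h3 with h3 | ⟨w, w1, w2, w3, w4⟩
    · left
      have hzS : ¬ K.Reachable x z := fun h => h2 ⟨z, hxz.ne', h, Or.inl ⟨rfl, h3⟩⟩
      exact same_miss (fun t ht h => by rw [← k1 z t ht hzS]; exact h) h3
    · right
      have hwx : w ≠ x := by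
        rintro rfl
        exact hxc (by rw [hφ.1]; exact w2)
      have hwS : ¬ K.Reachable x w := fun h => h2 ⟨w, hwx, h, Or.inr ⟨w1, w2, w4⟩⟩
      have hr : K.Reachable z w := SimpleGraph.Adj.reachable ⟨w1, Or.inl w2⟩
      refine ⟨w, w1, ?_, w3⟩
      rw [k1 z w w1 (fun h => hwS (SimpleGraph.Reachable.trans h hr))]
      exact w2

lemma num_bound (c : ℕ) (hc : 1 ≤ c) :
    (c + 1) * ((c + 4) * (c + 1) + 3) ≤ (c + 2) * 2 ^ (3 * c + 1) := by
  have h1 : c + 1 ≤ 2 ^ c := Nat.lt_two_pow_self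
  have h2 : (c + 1) ^ 3 ≤ (2 ^ c) ^ 3 := Nat.pow_le_pow_left h1 3
  have h3 : 2 ^ (3 * c + 1) = 2 * (2 ^ c) ^ 3 := by
    rw [pow_succ, mul_comm 3 c, pow_mul]; ring
  rw [h3]
  have h4 : (c + 4) * (c + 1) + 3 ≤ (c + 2) * (2 * (c + 1) ^ 2) := by nlinarith
  calc (c + 1) * ((c + 4) * (c + 1) + 3) ≤ (c + 1) * ((c + 2) * (2 * (c + 1) ^ 2)) :=
        Nat.mul_le_mul_left _ h4
    _ = (c + 2) * (2 * (c + 1) ^ 3) := by ring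
    _ ≤ _ := by gcongr

end Helpers

/-- Let `ε, λ ∈ (0,1)`, `c₀ = ⌈(1-ε)/ε⌉`, `f(ε) = (3c₀⁵+19c₀⁴+34c₀³+27c₀²+11c₀+2)/ε`,
`N = (c₀+2)(1/λ+1)^(3c₀+2)`, and `D₀ = max{f(ε), (3c₀+2)/λ², (N+1)/ε³}`. Let `Δ ≥ D₀`,
`q = (1-ε)Δ`, let `G` be `Δ`-critical, `xy ∈ E(G)` with `d(x) < q`, and `φ ∈ C^Δ(G - xy)`.
Then except for at most `N` vertices in `N(x, M_φ)`, every other vertex `z ∈ N(x, M_φ)`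
satisfies `|φ_b(z) - {φ(xz)}| < λΔ`. -/
theorem statement6 (G : SimpleGraph V) [DecidableRel G.Adj]
    (ε lam : ℝ) (hε : ε ∈ Set.Ioo (0 : ℝ) 1) (hlam : lam ∈ Set.Ioo (0 : ℝ) 1)
    (c₀ : ℕ) (hc₀ : c₀ = ⌈(1 - ε) / ε⌉₊)
    (f : ℝ) (hf : f = (3 * (c₀ : ℝ) ^ 5 + 19 * (c₀ : ℝ) ^ 4 + 34 * (c₀ : ℝ) ^ 3 +
      27 * (c₀ : ℝ) ^ 2 + 11 * (c₀ : ℝ) + 2) / ε)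
    (N : ℝ) (hN : N = ((c₀ : ℝ) + 2) * (1 / lam + 1) ^ (3 * c₀ + 2))
    (D₀ : ℝ) (hD₀ : D₀ = max f (max ((3 * (c₀ : ℝ) + 2) / lam ^ 2) ((N + 1) / ε ^ 3)))
    (hΔ : D₀ ≤ (G.maxDegree : ℝ)) (q : ℝ) (hq : q = (1 - ε) * G.maxDegree)
    (hG : IsDeltaCritical G)
    (x y : V) (hxy : G.Adj x y) (hx : (G.degree x : ℝ) < q)
    (H : SimpleGraph V) (hH : H = G.deleteEdges {s(x, y)})
    (φ : V → V → ℕ) (hφ : IsEdgeColoring H G.maxDegree φ) :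
    ∃ S : Set V, (S.ncard : ℝ) ≤ N ∧
      ∀ z ∈ NxM G H G.maxDegree φ q x y, z ∉ S →
        (((phib G H G.maxDegree φ q z \ {φ x z}).ncard : ℝ) < lam * G.maxDegree) := by
  classical
  obtain ⟨hε0, hε1⟩ := hε
  obtain ⟨hl0, hl1⟩ := hlam
  set k := G.maxDegree with hkdef
  -- numerical facts
  have hc1 : 1 ≤ c₀ := by
    rw [hc₀]; exact Nat.one_le_ceil_iff.2 (div_pos (by linarith) hε0)
  have hcε : 1 ≤ ((c₀ : ℝ) + 1) * ε := by
    have h := Nat.le_ceil ((1 - ε) / ε)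
    rw [← hc₀, div_le_iff₀ hε0] at h
    linarith
  have hc1R : (1 : ℝ) ≤ c₀ := by exact_mod_cast hc1
  have hfk : f ≤ k := le_trans (by rw [hD₀]; exact le_max_left _ _) hΔ
  have hεk : 2 * ((c₀ : ℝ) + 2) < ε * k := by
    rw [hf, div_le_iff₀ hε0] at hfk
    have h2 : (1 : ℝ) ≤ (c₀ : ℝ) ^ 2 := one_le_pow₀ hc1R
    have h3 : (1 : ℝ) ≤ (c₀ : ℝ) ^ 3 := one_le_pow₀ hc1R
    have h4 : (1 : ℝ) ≤ (c₀ : ℝ) ^ 4 := one_le_pow₀ hc1R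
    have h5 : (1 : ℝ) ≤ (c₀ : ℝ) ^ 5 := one_le_pow₀ hc1R
    linarith
  have hk0 : 0 < k := by
    rcases Nat.eq_zero_or_pos k with h | h
    · rw [h] at hεk
      simp only [Nat.cast_zero, mul_zero] at hεk
      linarith
    · exact h
  have hne : x ≠ y := hxy.ne
  have hH1 : ∀ a b, G.Adj a b → s(a, b) ≠ s(x, y) → H.Adj a b := by
    intro a b h h'
    rw [hH, SimpleGraph.deleteEdges_adj]
    exact ⟨h, h'⟩
  have hHG : ∀ a b, H.Adj a b → G.Adj a b := by
    intro a b h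
    rw [hH] at h
    exact SimpleGraph.deleteEdges_le _ h
  have hHxy : ¬ H.Adj x y := by
    rw [hH, SimpleGraph.deleteEdges_adj]
    exact fun h => h.2 rfl
  have hno : ∀ ψ, ¬ IsEdgeColoring G k ψ := by
    intro ψ hψ
    have h1 : chromIndex G ≤ k := Nat.sInf_le ⟨ψ, hψ⟩
    have h2 := hG.2.1
    omega
  have hq1 : 1 ≤ q := by
    have : 1 ≤ G.degree x := by
      rw [← SimpleGraph.card_neighborFinset_eq_degree]
      exact Finset.card_pos.2 ⟨y, by simpa using hxy⟩
    have : (1 : ℝ) ≤ G.degree x := by exact_mod_cast this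
    linarith
  have hmx : ∀ ψ : V → V → ℕ, ∀ c, ∃ g, g ∈ missing H k ψ x ∧ g ≠ c := by
    intro ψ c
    have h1 := low_card hHG k ψ x
    have h2 : (1 : ℝ) < (missF H k ψ x).card := by
      rw [hq] at hx
      linarith
    have h3 : 1 < (missF H k ψ x).card := by exact_mod_cast h2
    obtain ⟨g, hg, hgc⟩ := Finset.exists_mem_ne h3 c
    rw [mem_missF] at hg
    exact ⟨g, ⟨by simpa using hg.1, hg.2⟩, hgc⟩
  have hmul : ∀ m n : ℝ, 0 ≤ m → ((c₀ : ℝ) + 1) * n ≤ m → n ≤ ε * m := by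
    intro m n hm h
    have h1 : ε * (((c₀ : ℝ) + 1) * n) ≤ ε * m := mul_le_mul_of_nonneg_left h hε0.le
    by_cases hn : 0 ≤ n
    · nlinarith
    · have : 0 ≤ ε * m := by positivity
      linarith
  -- the case where `c` is missing at `x`
  have caseA : ∀ (ψ : V → V → ℕ) (c : ℕ) (Z : Finset V), IsEdgeColoring H k ψ →
      c ∈ missing H k ψ x → ((c₀ : ℝ) + 1) * (c₀ + 4) ≤ Z.card →
      (∀ z ∈ Z, H.Adj x z ∧ ψ x z ∈ Mset G H k ψ q x y ∧ ψ x z ≠ c ∧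
        (c ∉ present H ψ z ∨ ∃ w, H.Adj z w ∧ ψ z w = c ∧ (G.degree w : ℝ) < q)) → False := by
    intro ψ c Z hψ hc hZc hZ
    obtain ⟨g, hg, hgc⟩ := hmx ψ c
    obtain ⟨ψ', Z', hψ', hZ'c, hcc, hg', hZ'⟩ := stagePop hHG hψ hk0 hq hq1 hg hgc Z hZ
    have h1 := hmul _ _ (Nat.cast_nonneg _) hZc
    have h2 : ((c₀ + 2 : ℕ) : ℝ) ≤ Z'.card := by push_cast; linarith
    refine stageA hne hH1 hHG hHxy hno hψ' (missing_y hHG hHxy hxy (G.degree_le_maxDegree y) ψ')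
      hcε hεk hq (c := c) (g := g) ⟨hc.1, same_miss (fun t _ h => (hcc _ _).1 h) hc.2⟩ hg' Z'
      (by exact_mod_cast h2) ?_
    intro z hz
    obtain ⟨a1, a2, -, a3⟩ := hZ' z hz
    refine ⟨a1, a2, ?_⟩
    rcases a3 with a3 | ⟨w, w1, w2, -, w3⟩
    · exact Or.inl a3
    · exact Or.inr ⟨w, w1, w2, w3⟩
  -- the set of bad vertices
  let Z0 : Finset V := Finset.univ.filter (fun z => z ∈ NxM G H k φ q x y ∧
    lam * k ≤ ((phib G H k φ q z \ {φ x z}).ncard : ℝ))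
  refine ⟨(Z0 : Set V), ?_, ?_⟩
  swap
  · intro z hz hzS
    by_contra hcon
    exact hzS (Finset.mem_coe.2 (Finset.mem_filter.2 ⟨Finset.mem_univ _, hz, not_lt.1 hcon⟩))
  rw [Set.ncard_coe_finset]
  by_contra hbig
  push Not at hbig
  have hfin : ∀ z, (phib G H k φ q z \ {φ x z}).Finite := fun z =>
    (Set.finite_Icc 1 k).subset (fun a ha => ha.1.1)
  obtain ⟨c, hc, hpop⟩ := popular Z0 k hk0 lam (fun z => (hfin z).toFinset)
    (fun z _ a ha => by
      have := ((hfin z).mem_toFinset.1 ha).1.1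
      simpa using this)
    (fun z hz => by
      have := (Finset.mem_filter.1 hz).2.2
      rwa [Set.ncard_eq_toFinset_card _ (hfin z)] at this)
  have hck : c ∈ Set.Icc 1 k := by simpa using hc
  set Z1 := Z0.filter (fun z => c ∈ (hfin z).toFinset) with hZ1
  have hZ1c : ((c₀ : ℝ) + 1) * ((c₀ + 4) * (c₀ + 1) + 3) ≤ Z1.card := by
    have h1 : ((c₀ : ℝ) + 1) * ((c₀ + 4) * (c₀ + 1) + 3) ≤ (c₀ + 2) * 2 ^ (3 * c₀ + 1) := by
      exact_mod_cast num_bound c₀ hc1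
    have h2 : (2 : ℝ) ≤ 1 / lam + 1 := by
      have : (1 : ℝ) ≤ 1 / lam := by rw [le_div_iff₀ hl0]; linarith
      linarith
    have h3 : (2 : ℝ) ^ (3 * c₀ + 1) ≤ (1 / lam + 1) ^ (3 * c₀ + 1) :=
      pow_le_pow_left₀ (by norm_num) h2 _
    have h4 : lam * N = (1 + lam) * ((c₀ + 2) * (1 / lam + 1) ^ (3 * c₀ + 1)) := by
      rw [hN, pow_succ (1 / lam + 1) (3 * c₀ + 1)]
      field_simp
    have h5 : ((c₀ : ℝ) + 2) * 2 ^ (3 * c₀ + 1) ≤ (c₀ + 2) * (1 / lam + 1) ^ (3 * c₀ + 1) :=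
      mul_le_mul_of_nonneg_left h3 (by linarith)
    have h6 : (0 : ℝ) ≤ (c₀ + 2) * (1 / lam + 1) ^ (3 * c₀ + 1) := by positivity
    have h7 : lam * N ≤ lam * Z0.card := mul_le_mul_of_nonneg_left hbig.le hl0.le
    nlinarith
  have hZ1p : ∀ z ∈ Z1, H.Adj x z ∧ φ x z ∈ Mset G H k φ q x y ∧ φ x z ≠ c ∧
      (c ∉ present H φ z ∨ ∃ w, H.Adj z w ∧ φ z w = c ∧ (G.degree w : ℝ) < q) := by
    intro z hz
    obtain ⟨h1, h2⟩ := Finset.mem_filter.1 hz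
    have h3 := (Finset.mem_filter.1 h1).2.1
    have h4 := (hfin z).mem_toFinset.1 h2
    exact ⟨h3.1, h3.2, fun h => h4.2 h.symm, h4.1.2⟩
  by_cases hcx : c ∈ present H φ x
  · obtain ⟨g, hg, hgc⟩ := hmx φ c
    obtain ⟨ψ, Z2, hψ, hZ2c, hcc, hg', hZ2⟩ := stagePop hHG hφ hk0 hq hq1 hg hgc Z1 hZ1p
    have hcx' : c ∈ present H ψ x := by
      obtain ⟨u, hu, h⟩ := hcx
      exact ⟨u, hu, (hcc _ _).2 h⟩
    obtain ⟨ψ', Z3, hψ', hZ3c, hc', hZ3⟩ := stageB hψ hg' hck hcx' Z2 hZ2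
    refine caseA ψ' c Z3 hψ' hc' ?_ hZ3
    have h1 := hmul _ _ (Nat.cast_nonneg _) hZ1c
    have h2 : (Z2.card : ℝ) ≤ Z3.card + 1 := by exact_mod_cast hZ3c
    linarith
  · refine caseA φ c Z1 hφ ⟨hck, hcx⟩ ?_ hZ1p
    nlinarith
end
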